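/- Let C be a far-reaching subset of S₁, let 0 = t₀ < t₁ < … < t_m ≤ T, and let Y ∈ C^×× = (C^×)^×. Then there exists a sequence (Yⁿ) of elements of the solid, fork-convex hull of C (the smallest (process) solid and fork-convex subset of S₁ containing C) such that lim_n Yⁿ_{t_k} = Y_{t_k} a.s. for every k = 0, …, m. -/

import Mathlib

open MeasureTheory Filter Set
open scoped NNReal ENNReal

variable {Ω : Type*}

/-- A real function is càdlàg on `[0,T]`: right-continuous at every `t ∈ [0,T)` and
with left limits at every `t ∈ (0,T]`. -/
def CadlagOn (T : ℝ) (f : ℝ → ℝ) : Prop :=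
  (∀ t ∈ Set.Ico (0 : ℝ) T, Filter.Tendsto f (nhdsWithin t (Set.Ioi t)) (nhds (f t))) ∧
  (∀ t ∈ Set.Ioc (0 : ℝ) T, ∃ L : ℝ, Filter.Tendsto f (nhdsWithin t (Set.Iio t)) (nhds L))

/-- A positive process on `[0,T]`: adapted, nonnegative, with càdlàg paths. -/
def PosProc {m0 : MeasurableSpace Ω} (μ : Measure Ω) (T : ℝ)
    (ℱ : Filtration ℝ m0) (X : ℝ → Ω → ℝ) : Prop :=
  (∀ t ∈ Set.Icc (0 : ℝ) T, StronglyMeasurable[ℱ t] (X t)) ∧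
  (∀ᵐ ω ∂μ, ∀ t ∈ Set.Icc (0 : ℝ) T, 0 ≤ X t ω) ∧
  (∀ᵐ ω ∂μ, CadlagOn T (fun t => X t ω))

/-- A nonnegative càdlàg supermartingale on `[0,T]`. -/
def SuperMG {m0 : MeasurableSpace Ω} (μ : Measure Ω) (T : ℝ)
    (ℱ : Filtration ℝ m0) (X : ℝ → Ω → ℝ) : Prop :=
  PosProc μ T ℱ X ∧ (∀ t ∈ Set.Icc (0 : ℝ) T, Integrable (X t) μ) ∧
  ∀ s t : ℝ, s ∈ Set.Icc (0 : ℝ) T → t ∈ Set.Icc (0 : ℝ) T → s ≤ t →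
    μ[X t | ℱ s] ≤ᵐ[μ] X s

/-- Membership in `S₁`: a nonnegative càdlàg supermartingale with `Y₀ ≤ 1`. -/
def S1mem {m0 : MeasurableSpace Ω} (μ : Measure Ω) (T : ℝ)
    (ℱ : Filtration ℝ m0) (X : ℝ → Ω → ℝ) : Prop :=
  SuperMG μ T ℱ X ∧ ∀ᵐ ω ∂μ, X 0 ω ≤ 1

/-- Membership in `V`: a nonincreasing positive process with `B₀ ≤ 1`. -/
def Vmem {m0 : MeasurableSpace Ω} (μ : Measure Ω) (T : ℝ)
    (ℱ : Filtration ℝ m0) (B : ℝ → Ω → ℝ) : Prop :=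
  PosProc μ T ℱ B ∧
  (∀ᵐ ω ∂μ, ∀ s ∈ Set.Icc (0 : ℝ) T, ∀ t ∈ Set.Icc (0 : ℝ) T, s ≤ t → B t ω ≤ B s ω) ∧
  (∀ᵐ ω ∂μ, B 0 ω ≤ 1)

/-- The process polar `C^×`: all positive processes `Y` such that `XY` is a
supermartingale with `X₀Y₀ ≤ 1` for every `X ∈ C`. -/
def procPolar {m0 : MeasurableSpace Ω} (μ : Measure Ω) (T : ℝ)
    (ℱ : Filtration ℝ m0) (C : Set (ℝ → Ω → ℝ)) : Set (ℝ → Ω → ℝ) :=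
  {Y | PosProc μ T ℱ Y ∧ ∀ X ∈ C,
    SuperMG μ T ℱ (fun t ω => X t ω * Y t ω) ∧ ∀ᵐ ω ∂μ, X 0 ω * Y 0 ω ≤ 1}

/-- (Process) solidity: stability under multiplication by elements of `V`. -/
def ProcSolid {m0 : MeasurableSpace Ω} (μ : Measure Ω) (T : ℝ)
    (ℱ : Filtration ℝ m0) (C : Set (ℝ → Ω → ℝ)) : Prop :=
  ∀ Y ∈ C, ∀ B : ℝ → Ω → ℝ, Vmem μ T ℱ B → (fun t ω => Y t ω * B t ω) ∈ C

/-- Fork-convexity (with the convention `0/0 = 0`, which holds for Lean division). -/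
def ForkConvex {m0 : MeasurableSpace Ω} (μ : Measure Ω) (T : ℝ)
    (ℱ : Filtration ℝ m0) (C : Set (ℝ → Ω → ℝ)) : Prop :=
  ∀ s ∈ Set.Icc (0 : ℝ) T, ∀ h : Ω → ℝ, StronglyMeasurable[ℱ s] h →
    (∀ ω, 0 ≤ h ω) → (∀ ω, h ω ≤ 1) →
    ∀ Y1 ∈ C, ∀ Y2 ∈ C, ∀ Y3 ∈ C,
      (fun t ω => if t < s then Y1 t ω
        else Y1 s ω * (h ω * (Y2 t ω / Y2 s ω) + (1 - h ω) * (Y3 t ω / Y3 s ω))) ∈ C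

/-- Fatou convergence of a sequence of positive processes. -/
def FatouConv {m0 : MeasurableSpace Ω} (μ : Measure Ω) (T : ℝ) (Yn : ℕ → ℝ → Ω → ℝ) (Y : ℝ → Ω → ℝ) : Prop :=
  ∃ T' : Set ℝ, T'.Countable ∧ T' ⊆ Set.Icc 0 T ∧ Set.Icc (0 : ℝ) T ⊆ closure T' ∧
    ∀ᵐ ω ∂μ,
      (∀ t ∈ Set.Ico (0 : ℝ) T,
        (ENNReal.ofReal (Y t ω)
            = Filter.liminf
                (fun s => Filter.liminf (fun n => ENNReal.ofReal (Yn n s ω)) Filter.atTop)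
                (nhdsWithin t (Set.Ioi t ∩ T')) ∧
         ENNReal.ofReal (Y t ω)
            = Filter.limsup
                (fun s => Filter.limsup (fun n => ENNReal.ofReal (Yn n s ω)) Filter.atTop)
                (nhdsWithin t (Set.Ioi t ∩ T')))) ∧
      Filter.Tendsto (fun n => Yn n T ω) Filter.atTop (nhds (Y T ω))

/-- Closedness under Fatou convergence. -/
def FatouClosed {m0 : MeasurableSpace Ω} (μ : Measure Ω) (T : ℝ)
    (ℱ : Filtration ℝ m0) (C : Set (ℝ → Ω → ℝ)) : Prop :=
  ∀ (Yn : ℕ → ℝ → Ω → ℝ) (Y : ℝ → Ω → ℝ), (∀ n, Yn n ∈ C) → PosProc μ T ℱ Y →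
    FatouConv μ T Yn Y → Y ∈ C

/-- A set of processes is far-reaching if it has an element with `Y_T > 0` a.s. -/
def FarReaching {m0 : MeasurableSpace Ω} (μ : Measure Ω) (T : ℝ) (C : Set (ℝ → Ω → ℝ)) : Prop :=
  ∃ Y ∈ C, ∀ᵐ ω ∂μ, 0 < Y T ω

/-- The solid, fork-convex hull of `C`: the smallest (process) solid and fork-convex
subset of `S₁` containing `C`. -/
def solidForkHull {m0 : MeasurableSpace Ω} (μ : Measure Ω) (T : ℝ)
    (ℱ : Filtration ℝ m0) (C : Set (ℝ → Ω → ℝ)) : Set (ℝ → Ω → ℝ) :=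
  ⋂₀ {D | D ⊆ {X | S1mem μ T ℱ X} ∧ ProcSolid μ T ℱ D ∧ ForkConvex μ T ℱ D ∧ C ⊆ D}

/-- Extended (`[0,∞]`-valued) conditional expectation of a (nonnegative) function,
defined as the supremum of the conditional expectations of its truncations. -/
noncomputable def econd {mΩ : MeasurableSpace Ω} (μ : Measure Ω)
    (m : MeasurableSpace Ω) (f : Ω → ℝ) : Ω → ℝ≥0∞ :=
  fun ω => ⨆ n : ℕ, ENNReal.ofReal ((μ[fun ω' => min (f ω') n | m]) ω)

theorem condExp_le_of_setIntegral_le {m m0 : MeasurableSpace Ω} {μ : Measure Ω}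
    [IsFiniteMeasure μ] (hm : m ≤ m0) {f g : Ω → ℝ} (hf : Integrable f μ) (hg : Integrable g μ)
    (hgm : StronglyMeasurable[m] g)
    (h : ∀ A, MeasurableSet[m] A → ∫ ω in A, f ω ∂μ ≤ ∫ ω in A, g ω ∂μ) :
    μ[f | m] ≤ᵐ[μ] g := by
  refine ae_le_of_ae_le_trim (hm := hm) ?_
  refine ae_le_of_forall_setIntegral_le ?_ ?_ ?_
  · exact integrable_condExp.trim hm stronglyMeasurable_condExp
  · exact hg.trim hm hgm
  · intro A hA _
    rw [← setIntegral_trim hm stronglyMeasurable_condExp hA, ← setIntegral_trim hm hgm hA,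
      setIntegral_condExp hm hf hA]
    exact h A hA

theorem setIntegral_le_of_condExp_le {m m0 : MeasurableSpace Ω} {μ : Measure Ω}
    [IsFiniteMeasure μ] (hm : m ≤ m0) {f g : Ω → ℝ} (hf : Integrable f μ) (hg : Integrable g μ)
    (h : μ[f | m] ≤ᵐ[μ] g) {A : Set Ω} (hA : MeasurableSet[m] A) :
    ∫ ω in A, f ω ∂μ ≤ ∫ ω in A, g ω ∂μ := by
  rw [← setIntegral_condExp hm hf hA]
  exact setIntegral_mono_ae integrable_condExp.integrableOn hg.integrableOn h

theorem integrable_min_const {m0 : MeasurableSpace Ω} {μ : Measure Ω}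
    [IsFiniteMeasure μ] {f : Ω → ℝ} (hf : Integrable f μ) (M : ℝ) :
    Integrable (fun ω => min (f ω) M) μ :=
  hf.inf (integrable_const M)

/-- Truncated conditional inequalities pass to almost sure limits. -/
theorem condExp_le_of_tendsto {m m0 : MeasurableSpace Ω} {μ : Measure Ω}
    [IsFiniteMeasure μ] (hm : m ≤ m0) {W V : Ω → ℝ} {Wn Vn : ℕ → Ω → ℝ}
    (hW : Integrable W μ) (hV : Integrable V μ) (hVm : StronglyMeasurable[m] V)
    (hWn : ∀ n, Integrable (Wn n) μ) (hVn : ∀ n, Integrable (Vn n) μ)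
    (hWn0 : ∀ n, 0 ≤ᵐ[μ] Wn n) (hVn0 : ∀ n, 0 ≤ᵐ[μ] Vn n)
    (hWl : ∀ᵐ ω ∂μ, Tendsto (fun n => Wn n ω) atTop (nhds (W ω)))
    (hVl : ∀ᵐ ω ∂μ, Tendsto (fun n => Vn n ω) atTop (nhds (V ω)))
    (h : ∀ j, ∀ᶠ i in atTop, ∃ m' : MeasurableSpace Ω, m ≤ m' ∧ m' ≤ m0 ∧
      μ[Wn i | m'] ≤ᵐ[μ] Vn j) :
    μ[W | m] ≤ᵐ[μ] V := by
  refine condExp_le_of_setIntegral_le hm hW hV hVm fun A hA => ?_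
  have hlim : ∀ (F : ℕ → Ω → ℝ) (G : Ω → ℝ) (M : ℝ), 0 ≤ M → (∀ n, Integrable (F n) μ) →
      (∀ n, 0 ≤ᵐ[μ] F n) → (∀ᵐ ω ∂μ, Tendsto (fun n => F n ω) atTop (nhds (G ω))) →
      Tendsto (fun n => ∫ ω in A, min (F n ω) M ∂μ) atTop
        (nhds (∫ ω in A, min (G ω) M ∂μ)) := by
    intro F G M hM hF hF0 hFG
    refine tendsto_integral_of_dominated_convergence (fun _ => M) ?_ ?_ ?_ ?_
    · exact fun n => (integrable_min_const (hF n) M).aestronglyMeasurable.restrict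
    · exact integrable_const _
    · intro n
      filter_upwards [ae_restrict_of_ae (hF0 n)] with ω hω
      have hω : 0 ≤ F n ω := hω
      rw [Real.norm_of_nonneg (le_min hω hM)]
      exact min_le_right _ _
    · filter_upwards [ae_restrict_of_ae hFG] with ω hω
      exact hω.min tendsto_const_nhds
  have hM : ∀ M : ℝ, 0 ≤ M → ∫ ω in A, min (W ω) M ∂μ ≤ ∫ ω in A, min (V ω) M ∂μ := by
    intro M hM0
    have hj : ∀ j, ∫ ω in A, min (W ω) M ∂μ ≤ ∫ ω in A, min (Vn j ω) M ∂μ := by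
      intro j
      refine le_of_tendsto (hlim Wn W M hM0 hWn hWn0 hWl) ?_
      filter_upwards [h j] with i hi
      obtain ⟨m', hmm', hm', hle⟩ := hi
      refine setIntegral_le_of_condExp_le hm' (integrable_min_const (hWn i) M)
        (integrable_min_const (hVn j) M) ?_ (hmm' A hA)
      have h1 : μ[fun ω => min (Wn i ω) M | m'] ≤ᵐ[μ] μ[Wn i | m'] :=
        condExp_mono (integrable_min_const (hWn i) M) (hWn i)
          (ae_of_all _ fun ω => min_le_left _ _)
      have h2 : μ[fun ω => min (Wn i ω) M | m'] ≤ᵐ[μ] μ[fun _ => M | m'] :=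
        condExp_mono (integrable_min_const (hWn i) M) (integrable_const M)
          (ae_of_all _ fun ω => min_le_right _ _)
      rw [condExp_const hm'] at h2
      filter_upwards [h1, h2, hle] with ω a b c
      exact le_min (a.trans c) b
    exact ge_of_tendsto' (hlim Vn V M hM0 hVn hVn0 hVl) hj
  have hinf : ∀ G : Ω → ℝ, Integrable G μ →
      Tendsto (fun n : ℕ => ∫ ω in A, min (G ω) (n : ℝ) ∂μ) atTop
        (nhds (∫ ω in A, G ω ∂μ)) := by
    intro G hG
    refine tendsto_integral_of_dominated_convergence (fun ω => ‖G ω‖) ?_ ?_ ?_ ?_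
    · exact fun n => (integrable_min_const hG n).aestronglyMeasurable.restrict
    · exact hG.norm.integrableOn
    · intro n
      refine ae_of_all _ fun ω => ?_
      rw [Real.norm_eq_abs, Real.norm_eq_abs]
      have hn : (0 : ℝ) ≤ n := n.cast_nonneg
      rcases le_total (G ω) n with h1 | h1
      · rw [min_eq_left h1]
      · rw [min_eq_right h1, abs_of_nonneg hn]; exact h1.trans (le_abs_self _)
    · refine ae_of_all _ fun ω => ?_
      obtain ⟨N, hN⟩ := exists_nat_ge (G ω)
      refine tendsto_const_nhds.congr' ?_
      filter_upwards [eventually_ge_atTop N] with n hn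
      rw [min_eq_left (hN.trans (by exact_mod_cast hn))]
  exact le_of_tendsto_of_tendsto' (hinf W hW) (hinf V hV) fun n => hM n n.cast_nonneg

/-- Essential supremum of an upward directed dominated family of nonnegative functions,
realised as the limit of a sequence in the family. -/
theorem exists_esssup_of_directed {ι : Type*} {m m0 : MeasurableSpace Ω} {μ : Measure Ω}
    [IsFiniteMeasure μ] (hm : m ≤ m0) (S : Set ι) (hS : S.Nonempty) (ψ : ι → Ω → ℝ) (G : Ω → ℝ)
    (hG : Integrable G μ) (hψm : ∀ x ∈ S, StronglyMeasurable[m] (ψ x))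
    (hψ0 : ∀ x ∈ S, 0 ≤ᵐ[μ] ψ x) (hψG : ∀ x ∈ S, ψ x ≤ᵐ[μ] G)
    (hdir : ∀ x ∈ S, ∀ y ∈ S, ∃ z ∈ S, ψ x ≤ᵐ[μ] ψ z ∧ ψ y ≤ᵐ[μ] ψ z) :
    ∃ U : Ω → ℝ, StronglyMeasurable[m] U ∧ (∀ x ∈ S, ψ x ≤ᵐ[μ] U) ∧
      ∃ x : ℕ → ι, (∀ n, x n ∈ S) ∧
        ∀ᵐ ω ∂μ, Tendsto (fun n => ψ (x n) ω) atTop (nhds (U ω)) := by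
  have hInt : ∀ x ∈ S, Integrable (ψ x) μ := by
    intro x hx
    refine hG.mono' ((hψm x hx).mono hm).aestronglyMeasurable ?_
    filter_upwards [hψ0 x hx, hψG x hx] with ω h0 h1
    rw [Real.norm_of_nonneg h0]; exact h1
  set I : Set ℝ := (fun x => ∫ ω, ψ x ω ∂μ) '' S with hI
  have hIne : I.Nonempty := hS.image _
  have hIbd : BddAbove I := by
    refine ⟨∫ ω, G ω ∂μ, ?_⟩
    rintro _ ⟨x, hx, rfl⟩
    exact integral_mono_ae (hInt x hx) hG (hψG x hx)
  set c := sSup I with hc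
  have hz : ∀ n : ℕ, ∃ z ∈ S, c - 1 / ((n : ℝ) + 1) < ∫ ω, ψ z ω ∂μ := by
    intro n
    obtain ⟨_, ⟨z, hzS, rfl⟩, hlt⟩ := exists_lt_of_lt_csSup hIne
      (show c - 1 / ((n : ℝ) + 1) < c by
        have : (0 : ℝ) < 1 / ((n : ℝ) + 1) := by positivity
        linarith)
    exact ⟨z, hzS, hlt⟩
  choose z hzS hzc using hz
  choose! d hdS hd1 hd2 using hdir
  let x : ℕ → ι := fun n => Nat.rec (z 0) (fun k xk => d xk (z (k + 1))) n
  have hx0 : x 0 = z 0 := rfl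
  have hxs : ∀ n, x (n + 1) = d (x n) (z (n + 1)) := fun n => rfl
  have hxS : ∀ n, x n ∈ S := by
    intro n
    induction n with
    | zero => exact hzS 0
    | succ k ih => rw [hxs]; exact hdS _ ih _ (hzS _)
  have hxz : ∀ n, ψ (z n) ≤ᵐ[μ] ψ (x n) := by
    intro n
    cases n with
    | zero => exact ae_of_all _ fun ω => le_rfl
    | succ k => rw [hxs]; exact hd2 _ (hxS k) _ (hzS _)
  have hmono : ∀ᵐ ω ∂μ, Monotone fun n => ψ (x n) ω := by
    have : ∀ n, ψ (x n) ≤ᵐ[μ] ψ (x (n + 1)) := fun n => by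
      rw [hxs]; exact hd1 _ (hxS n) _ (hzS _)
    filter_upwards [ae_all_iff.2 this] with ω hω
    exact monotone_nat_of_le_succ hω
  have hall0 : ∀ᵐ ω ∂μ, ∀ n, 0 ≤ ψ (x n) ω := ae_all_iff.2 fun n => hψ0 _ (hxS n)
  have hallG : ∀ᵐ ω ∂μ, ∀ n, ψ (x n) ω ≤ G ω := ae_all_iff.2 fun n => hψG _ (hxS n)
  let U : Ω → ℝ := fun ω => ⨆ n, ψ (x n) ω
  have hUm : StronglyMeasurable[m] U :=
    (Measurable.iSup fun n => (hψm _ (hxS n)).measurable).stronglyMeasurable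
  have hUl : ∀ᵐ ω ∂μ, Tendsto (fun n => ψ (x n) ω) atTop (nhds (U ω)) := by
    filter_upwards [hmono, hallG] with ω h1 h2
    exact tendsto_atTop_ciSup h1 ⟨G ω, by rintro _ ⟨n, rfl⟩; exact h2 n⟩
  refine ⟨U, hUm, ?_, x, hxS, hUl⟩
  have hU0 : ∀ᵐ ω ∂μ, 0 ≤ U ω := by
    filter_upwards [hall0, hUl] with ω h1 h2 using ge_of_tendsto' h2 h1
  have hUG : ∀ᵐ ω ∂μ, U ω ≤ G ω := by
    filter_upwards [hallG, hUl] with ω h1 h2 using le_of_tendsto' h2 h1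
  have hUint : Integrable U μ := by
    refine hG.mono' (hUm.mono hm).aestronglyMeasurable ?_
    filter_upwards [hU0, hUG] with ω h0 h1
    rw [Real.norm_of_nonneg h0]; exact h1
  have hcU : c ≤ ∫ ω, U ω ∂μ := by
    refine le_of_tendsto' (f := fun n : ℕ => c - 1 / ((n : ℝ) + 1)) (x := atTop) ?_ fun n => ?_
    · simpa using tendsto_const_nhds.sub (tendsto_one_div_add_atTop_nhds_zero_nat (𝕜 := ℝ))
    · refine (hzc n).le.trans (integral_mono_ae (hInt _ (hzS n)) hUint ?_)
      filter_upwards [hxz n, hmono, hUl] with ω h1 h2 h3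
      exact h1.trans (h2.ge_of_tendsto h3 n)
  intro y hy
  have hmaxint : ∀ n, ∫ ω, max (ψ y ω) (ψ (x n) ω) ∂μ ≤ c := by
    intro n
    refine le_trans ?_ (le_csSup hIbd ⟨d y (x n), hdS _ hy _ (hxS n), rfl⟩)
    refine integral_mono_ae ((hInt y hy).sup (hInt _ (hxS n))) (hInt _ (hdS _ hy _ (hxS n))) ?_
    filter_upwards [hd1 _ hy _ (hxS n), hd2 _ hy _ (hxS n)] with ω h1 h2 using max_le h1 h2
  have hmaxU : ∫ ω, max (ψ y ω) (U ω) ∂μ ≤ c := by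
    refine le_of_tendsto' (f := fun n => ∫ ω, max (ψ y ω) (ψ (x n) ω) ∂μ) (x := atTop) ?_ hmaxint
    refine tendsto_integral_of_dominated_convergence G ?_ hG ?_ ?_
    · exact fun n => ((hInt y hy).sup (hInt _ (hxS n))).aestronglyMeasurable
    · intro n
      filter_upwards [hψ0 y hy, hψG y hy, hψG _ (hxS n)] with ω h0 h1 h2
      rw [Real.norm_of_nonneg (le_max_of_le_left h0)]
      exact max_le h1 h2
    · filter_upwards [hUl] with ω hω
      exact tendsto_const_nhds.max hω
  have hsupint : Integrable (fun ω => max (ψ y ω) (U ω)) μ := (hInt y hy).sup hUint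
  have hzero : ∫ ω, (max (ψ y ω) (U ω) - U ω) ∂μ = 0 := by
    apply le_antisymm
    · rw [integral_sub hsupint hUint]; linarith
    · exact integral_nonneg fun ω => sub_nonneg.2 (le_max_right _ _)
  rw [integral_eq_zero_iff_of_nonneg (fun ω => sub_nonneg.2 (le_max_right _ _))
    (hsupint.sub hUint)] at hzero
  filter_upwards [hzero] with ω hω
  have : max (ψ y ω) (U ω) - U ω = 0 := hω
  have := le_max_left (ψ y ω) (U ω)
  linarith

/-- Separation of a bounded function from a convex set of nonnegative functions stable under
multiplication by indicators. -/
theorem exists_separating_of_not_approx {m m0 : MeasurableSpace Ω} {μ : Measure Ω}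
    [IsFiniteMeasure μ] (hm : m ≤ m0) (A : Set (Ω → ℝ)) (hne : A.Nonempty)
    (hAm : ∀ f ∈ A, StronglyMeasurable[m] f) (hA2 : ∀ f ∈ A, MemLp f 2 μ)
    (hA0 : ∀ f ∈ A, 0 ≤ᵐ[μ] f)
    (hconv : ∀ f₁ ∈ A, ∀ f₂ ∈ A, ∀ a b : ℝ, 0 ≤ a → 0 ≤ b → a + b = 1 →
      ∃ f ∈ A, f =ᵐ[μ] fun ω => a * f₁ ω + b * f₂ ω)
    (hsol : ∀ f ∈ A, ∀ B, MeasurableSet[m] B → ∃ f' ∈ A, f' =ᵐ[μ] B.indicator f)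
    (y : Ω → ℝ) (hym : StronglyMeasurable[m] y) (n : ℝ) (hn : 0 < n) (hy0 : 0 ≤ᵐ[μ] y)
    (hyn : ∀ᵐ ω ∂μ, y ω ≤ n)
    (ε : ℝ) (hε : 0 < ε) (hsep : ∀ f ∈ A, ε ≤ ∫ ω, (y ω - f ω) ^ 2 ∂μ) :
    ∃ g : Ω → ℝ, StronglyMeasurable[m] g ∧ (∀ ω, 0 ≤ g ω) ∧ (∀ ω, g ω ≤ n) ∧
      ∃ c : ℝ, c < ∫ ω, y ω * g ω ∂μ ∧ ∀ f ∈ A, ∫ ω, f ω * g ω ∂μ ≤ c := by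
  have hy2 : MemLp y 2 μ := by
    refine MemLp.of_bound (hym.mono hm).aestronglyMeasurable n ?_
    filter_upwards [hy0, hyn] with ω h0 h1
    rw [Real.norm_of_nonneg h0]; exact h1
  set K₀ : Set (Lp ℝ 2 μ) := {F | ∃ f ∈ A, F =ᵐ[μ] f} with hK₀
  have hK₀ne : K₀.Nonempty := by
    obtain ⟨f, hf⟩ := hne
    exact ⟨(hA2 f hf).toLp f, f, hf, MemLp.coeFn_toLp _⟩
  have hK₀c : Convex ℝ K₀ := by
    rintro F₁ ⟨f₁, hf₁, e₁⟩ F₂ ⟨f₂, hf₂, e₂⟩ a b ha hb hab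
    obtain ⟨f, hf, e⟩ := hconv f₁ hf₁ f₂ hf₂ a b ha hb hab
    refine ⟨f, hf, ?_⟩
    filter_upwards [Lp.coeFn_add (a • F₁) (b • F₂), Lp.coeFn_smul a F₁, Lp.coeFn_smul b F₂,
      e₁, e₂, e] with ω h1 h2 h3 h4 h5 h6
    rw [h1, h6]
    simp [h2, h3, h4, h5]
  set K := closure K₀ with hK
  have hKc : Convex ℝ K := hK₀c.closure
  obtain ⟨F, hFK, hF⟩ := exists_norm_eq_iInf_of_complete_convex (K := K) hK₀ne.closure
    isClosed_closure.isComplete hKc (hy2.toLp y)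
  have hproj := (norm_eq_iInf_iff_real_inner_le_zero hKc hFK).1 hF
  set D : Lp ℝ 2 μ := hy2.toLp y - F with hD
  have hyD : y =ᵐ[μ] hy2.toLp y := (MemLp.coeFn_toLp hy2).symm
  have hD2 : MemLp D 2 μ := Lp.memLp D
  have hDint : Integrable D μ := hD2.integrable (by norm_num)
  -- the closure consists of nonnegative functions
  have hF0 : 0 ≤ F := by
    have hcl : IsClosed {G : Lp ℝ 2 μ | 0 ≤ G} := isClosed_Ici
    refine closure_minimal (s := K₀) ?_ hcl hFK
    rintro G ⟨f, hf, e⟩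
    show 0 ≤ G
    rw [← Lp.coeFn_nonneg]
    filter_upwards [e, hA0 f hf] with ω h1 h2
    rw [h1]; exact h2
  have hDle : ∀ᵐ ω ∂μ, D ω ≤ n := by
    filter_upwards [Lp.coeFn_sub (hy2.toLp y) F, (Lp.coeFn_nonneg F).2 hF0, hyD, hyn]
      with ω h1 h2 h3 h4
    have h2 : 0 ≤ F ω := h2
    rw [hD, h1, Pi.sub_apply, ← h3]; linarith
  set g₀ : Ω → ℝ := μ[D | m] with hg₀
  have hg₀m : StronglyMeasurable[m] g₀ := stronglyMeasurable_condExp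
  have hg₀n : ∀ᵐ ω ∂μ, g₀ ω ≤ n := by
    have := condExp_mono (m := m) hDint (integrable_const n) hDle
    rw [condExp_const hm] at this
    exact this
  have hprod : ∀ f : Ω → ℝ, StronglyMeasurable[m] f → MemLp f 2 μ →
      Integrable (fun ω => f ω * D ω) μ ∧ Integrable (fun ω => f ω * g₀ ω) μ ∧
      ∫ ω, f ω * g₀ ω ∂μ = ∫ ω, f ω * D ω ∂μ := by
    intro f hfm hf2
    have hi : Integrable (f * ⇑D) μ := hf2.integrable_mul hD2
    have he := condExp_mul_of_stronglyMeasurable_left hfm hi hDint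
    refine ⟨hi, integrable_condExp.congr he, ?_⟩
    exact (integral_congr_ae he).symm.trans (integral_condExp hm)
  set c := ∫ ω, F ω * D ω ∂μ with hc
  have hinner : ∀ G H : Lp ℝ 2 μ, inner ℝ G H = ∫ ω, H ω * G ω ∂μ := by
    intro G H
    rw [L2.inner_def]
    rfl
  have hFD : Integrable (fun ω => F ω * D ω) μ := (Lp.memLp F).integrable_mul hD2
  have hAc : ∀ f ∈ A, ∫ ω, f ω * g₀ ω ∂μ ≤ c := by
    intro f hf
    obtain ⟨h1, h2, h3⟩ := hprod f (hAm f hf) (hA2 f hf)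
    rw [h3]
    have := hproj ((hA2 f hf).toLp f) (subset_closure ⟨f, hf, MemLp.coeFn_toLp _⟩)
    rw [inner_sub_right, hinner, hinner] at this
    have e : ∫ ω, ((hA2 f hf).toLp f) ω * D ω ∂μ = ∫ ω, f ω * D ω ∂μ := by
      refine integral_congr_ae ?_
      filter_upwards [MemLp.coeFn_toLp (hA2 f hf)] with ω h
      rw [h]
    rw [e] at this
    linarith
  have hDpos : 0 < ‖D‖ ^ 2 := by
    rcases eq_or_ne D 0 with h0 | h0
    · exfalso
      have hFy : F = hy2.toLp y := (sub_eq_zero.1 h0).symm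
      rw [hFy, hK, Metric.mem_closure_iff] at hFK
      obtain ⟨G, ⟨f, hf, e⟩, hG⟩ := hFK (Real.sqrt ε) (Real.sqrt_pos.2 hε)
      have h1 := hsep f hf
      have h2 : ‖hy2.toLp y - G‖ ^ 2 = ∫ ω, (y ω - f ω) ^ 2 ∂μ := by
        rw [← real_inner_self_eq_norm_sq, hinner]
        refine integral_congr_ae ?_
        filter_upwards [Lp.coeFn_sub (hy2.toLp y) G, hyD, e] with ω h1 h2 h3
        rw [h1, Pi.sub_apply, ← h2, h3]; ring
      rw [dist_eq_norm] at hG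
      rw [← h2] at h1
      have := (Real.lt_sqrt (norm_nonneg _)).1 hG
      linarith
    · exact pow_pos (norm_pos_iff.2 h0) 2
  have hyg₀ : ∫ ω, y ω * g₀ ω ∂μ = c + ‖D‖ ^ 2 := by
    obtain ⟨h1, h2, h3⟩ := hprod y hym hy2
    have hDD : Integrable (fun ω => D ω * D ω) μ := hD2.integrable_mul hD2
    rw [h3, ← real_inner_self_eq_norm_sq, hinner, hc, ← integral_add hFD hDD]
    refine integral_congr_ae ?_
    filter_upwards [Lp.coeFn_sub (hy2.toLp y) F, hyD] with ω h1 h3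
    have : D ω = y ω - F ω := by rw [hD, h1, Pi.sub_apply, ← h3]
    rw [this]; ring
  set g : Ω → ℝ := fun ω => min (max (g₀ ω) 0) n with hg
  have hgm : StronglyMeasurable[m] g :=
    ((hg₀m.measurable.max measurable_const).min measurable_const).stronglyMeasurable
  have hg0 : ∀ ω, 0 ≤ g ω := fun ω => le_min (le_max_right _ _) hn.le
  have hgn : ∀ ω, g ω ≤ n := fun ω => min_le_right _ _
  have hgae : ∀ᵐ ω ∂μ, g ω = max (g₀ ω) 0 := by
    filter_upwards [hg₀n] with ω h
    exact min_eq_left (max_le h hn.le)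
  have hbd : ∀ f : Ω → ℝ, Integrable f μ → Integrable (fun ω => f ω * g ω) μ := by
    intro f hf
    refine hf.mul_bdd (c := n) (hgm.mono hm).aestronglyMeasurable (ae_of_all _ fun ω => ?_)
    rw [Real.norm_of_nonneg (hg0 ω)]; exact hgn ω
  refine ⟨g, hgm, hg0, hgn, c, ?_, ?_⟩
  · obtain ⟨h1, h2, h3⟩ := hprod y hym hy2
    calc c < c + ‖D‖ ^ 2 := by linarith
      _ = ∫ ω, y ω * g₀ ω ∂μ := hyg₀.symm
      _ ≤ ∫ ω, y ω * g ω ∂μ := by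
        refine integral_mono_ae h2 (hbd y (hy2.integrable (by norm_num))) ?_
        filter_upwards [hgae, hy0] with ω h4 h5
        show y ω * g₀ ω ≤ y ω * g ω
        rw [h4]
        exact mul_le_mul_of_nonneg_left (le_max_left _ _) h5
  · intro f hf
    obtain ⟨f', hf', e⟩ := hsol f hf {ω | 0 < g₀ ω}
      (measurableSet_lt measurable_const hg₀m.measurable)
    refine le_trans (le_of_eq ?_) (hAc f' hf')
    refine integral_congr_ae ?_
    filter_upwards [e, hgae] with ω h1 h2
    rw [h1, h2]
    by_cases h : 0 < g₀ ω
    · rw [indicator_of_mem (by exact h), max_eq_left h.le]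
    · rw [indicator_of_notMem (by exact h), max_eq_right (not_lt.1 h)]; ring

/-- The `i`-th point of the dyadic grid of level `n` on `[s,r]`. -/
noncomputable def gridPt (s r : ℝ) (n i : ℕ) : ℝ := s + (r - s) * (i / 2 ^ n)

/-- The set of dyadic grid points of `[s,r]`. -/
def gridSet (s r : ℝ) : Set ℝ := {q | ∃ n i : ℕ, i ≤ 2 ^ n ∧ q = gridPt s r n i}

theorem gridPt_lt_iff {s r : ℝ} (h : s < r) (n i j : ℕ) :
    gridPt s r n i < gridPt s r n j ↔ i < j := by
  unfold gridPt
  rw [add_lt_add_iff_left, mul_lt_mul_iff_right₀ (sub_pos.2 h),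
    div_lt_div_iff_of_pos_right (by positivity), Nat.cast_lt]

theorem gridPt_mono {s r : ℝ} (h : s < r) (n : ℕ) : Monotone (gridPt s r n) := by
  intro i j hij
  exact le_of_not_gt fun hlt => absurd ((gridPt_lt_iff h n j i).1 hlt) (not_lt.2 hij)

theorem gridPt_zero (s r : ℝ) (n : ℕ) : gridPt s r n 0 = s := by simp [gridPt]

theorem gridPt_last (s r : ℝ) (n : ℕ) : gridPt s r n (2 ^ n) = r := by
  simp [gridPt]

theorem gridPt_mem {s r : ℝ} (h : s < r) {n i : ℕ} (hi : i ≤ 2 ^ n) :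
    gridPt s r n i ∈ Icc s r :=
  ⟨(gridPt_zero s r n).symm.le.trans (gridPt_mono h n (Nat.zero_le i)),
    (gridPt_mono h n hi).trans (gridPt_last s r n).le⟩

theorem gridPt_refine (s r : ℝ) (n k i : ℕ) :
    gridPt s r n i = gridPt s r (n + k) (i * 2 ^ k) := by
  unfold gridPt
  push_cast
  rw [pow_add, mul_div_mul_right _ _ (by positivity)]

theorem gridSet_subset {s r : ℝ} (h : s < r) : gridSet s r ⊆ Icc s r := by
  rintro _ ⟨n, i, hi, rfl⟩; exact gridPt_mem h hi

theorem eventually_gridPt_of_mem {s r q : ℝ} (hq : q ∈ gridSet s r) :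
    ∀ᶠ n in atTop, ∃ i ≤ 2 ^ n, q = gridPt s r n i := by
  obtain ⟨n, i, hi, rfl⟩ := hq
  filter_upwards [eventually_ge_atTop n] with N hN
  obtain ⟨k, rfl⟩ := Nat.exists_eq_add_of_le hN
  exact ⟨i * 2 ^ k, by rw [pow_add]; exact Nat.mul_le_mul_right _ hi, gridPt_refine s r n k i⟩

theorem exists_gridSet_between {s r u v : ℝ} (hsu : s ≤ u) (huv : u < v) (hvr : v ≤ r) :
    ∃ q ∈ gridSet s r, u < q ∧ q < v := by
  have h : s < r := hsu.trans_lt (huv.trans_le hvr)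
  have hd : 0 < r - s := sub_pos.2 h
  obtain ⟨n, hn⟩ := pow_unbounded_of_one_lt ((r - s) / (v - u)) one_lt_two
  rw [div_lt_iff₀ (sub_pos.2 huv)] at hn
  have h2 : (0 : ℝ) < 2 ^ n := by positivity
  set x := (u - s) / (r - s) * 2 ^ n with hx
  have hx0 : 0 ≤ x := by
    have : 0 ≤ u - s := sub_nonneg.2 hsu
    positivity
  have hxu : u = s + (r - s) * (x / 2 ^ n) := by
    rw [hx]; field_simp; ring
  have h1 := Nat.lt_floor_add_one x
  have h3 := Nat.floor_le hx0
  have hlt : gridPt s r n (⌊x⌋₊ + 1) < v := by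
    have : gridPt s r n (⌊x⌋₊ + 1) ≤ u + (r - s) / 2 ^ n := by
      rw [hxu]; unfold gridPt; push_cast
      rw [add_assoc, add_le_add_iff_left, add_div, mul_add, mul_one_div]
      gcongr
    have h4 : (r - s) / 2 ^ n < v - u := by rw [div_lt_iff₀ h2]; linarith
    linarith
  refine ⟨gridPt s r n (⌊x⌋₊ + 1), ⟨n, _, ?_, rfl⟩, ?_, hlt⟩
  · have : gridPt s r n (⌊x⌋₊ + 1) < gridPt s r n (2 ^ n) := by
      rw [gridPt_last]; exact hlt.trans_le hvr
    exact ((gridPt_lt_iff h n _ _).1 this).le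
  · rw [hxu]; unfold gridPt; push_cast
    gcongr

/-- The right-limit of `f` at `u` along `Q`. -/
noncomputable def rightReg (Q : Set ℝ) (f : ℝ → ℝ) (u : ℝ) : ℝ :=
  limUnder (nhdsWithin u (Q ∩ Ioi u)) f

theorem neBot_nhdsWithin_Ioi_of_between {s r u : ℝ} {Q : Set ℝ}
    (hQ : ∀ x y, s ≤ x → x < y → y ≤ r → ∃ q ∈ Q, x < q ∧ q < y) (hu : u ∈ Ico s r) :
    (nhdsWithin u (Q ∩ Ioi u)).NeBot := by
  rw [← mem_closure_iff_nhdsWithin_neBot, Metric.mem_closure_iff]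
  intro ε hε
  obtain ⟨q, hq, h1, h2⟩ := hQ u (min r (u + ε)) hu.1 (lt_min hu.2 (by linarith)) (min_le_left _ _)
  refine ⟨q, ⟨hq, h1⟩, ?_⟩
  rw [Real.dist_eq, abs_sub_comm, abs_of_pos (sub_pos.2 h1)]
  linarith [h2.trans_le (min_le_right _ _)]

theorem tendsto_rightReg {u : ℝ} {Q : Set ℝ} {f : ℝ → ℝ}
    (hr : ∃ L, Tendsto f (nhdsWithin u (Q ∩ Ioi u)) (nhds L)) :
    Tendsto f (nhdsWithin u (Q ∩ Ioi u)) (nhds (rightReg Q f u)) :=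
  tendsto_nhds_limUnder hr

theorem rightReg_mem_of_forall {s r u x y : ℝ} {Q : Set ℝ} {f : ℝ → ℝ} {S : Set ℝ}
    (hS : IsClosed S)
    (hQ : ∀ x y, s ≤ x → x < y → y ≤ r → ∃ q ∈ Q, x < q ∧ q < y) (hu : u ∈ Ico s r)
    (hr : ∃ L, Tendsto f (nhdsWithin u (Q ∩ Ioi u)) (nhds L))
    (hxu : x ≤ u) (huy : u < y) (h : ∀ q ∈ Q, x < q → q < y → f q ∈ S) :
    rightReg Q f u ∈ S := by
  have := neBot_nhdsWithin_Ioi_of_between hQ hu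
  refine hS.mem_of_tendsto (tendsto_rightReg hr) ?_
  have h1 : ∀ᶠ q in nhdsWithin u (Q ∩ Ioi u), q < y :=
    mem_nhdsWithin_of_mem_nhds (Iio_mem_nhds huy)
  filter_upwards [h1, self_mem_nhdsWithin] with q h2 h3
  exact h q h3.1 (hxu.trans_lt h3.2) h2

theorem rightReg_tendsto_right {s r u : ℝ} {Q : Set ℝ} {f : ℝ → ℝ}
    (hQ : ∀ x y, s ≤ x → x < y → y ≤ r → ∃ q ∈ Q, x < q ∧ q < y)
    (hr : ∀ u ∈ Ico s r, ∃ L, Tendsto f (nhdsWithin u (Q ∩ Ioi u)) (nhds L))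
    (hu : u ∈ Ico s r) :
    Tendsto (rightReg Q f) (nhdsWithin u (Ioi u)) (nhds (rightReg Q f u)) := by
  rw [(Metric.nhds_basis_closedBall).tendsto_right_iff]
  intro ε hε
  have h := (tendsto_rightReg (hr u hu)) (Metric.closedBall_mem_nhds _ hε)
  rw [mem_map, Metric.mem_nhdsWithin_iff] at h
  obtain ⟨δ, hδ, h⟩ := h
  have hy : u < min r (u + δ) := lt_min hu.2 (by linarith)
  filter_upwards [Ioo_mem_nhdsGT hy] with v hv
  refine rightReg_mem_of_forall (x := u) Metric.isClosed_closedBall hQ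
    ⟨hu.1.trans hv.1.le, hv.2.trans_le (min_le_left _ _)⟩
    (hr v ⟨hu.1.trans hv.1.le, hv.2.trans_le (min_le_left _ _)⟩) hv.1.le hv.2 ?_
  intro q hq h1 h2
  refine h ⟨?_, hq, h1⟩
  rw [Metric.mem_ball, Real.dist_eq, abs_of_pos (sub_pos.2 h1)]
  linarith [h2.trans_le (min_le_right _ _)]

theorem rightReg_tendsto_left {s r u L : ℝ} {Q : Set ℝ} {f : ℝ → ℝ}
    (hQ : ∀ x y, s ≤ x → x < y → y ≤ r → ∃ q ∈ Q, x < q ∧ q < y)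
    (hr : ∀ u ∈ Ico s r, ∃ L, Tendsto f (nhdsWithin u (Q ∩ Ioi u)) (nhds L))
    (hu : u ∈ Ioc s r) (hl : Tendsto f (nhdsWithin u (Q ∩ Iio u)) (nhds L)) :
    Tendsto (rightReg Q f) (nhdsWithin u (Iio u)) (nhds L) := by
  rw [(Metric.nhds_basis_closedBall).tendsto_right_iff]
  intro ε hε
  have h := hl (Metric.closedBall_mem_nhds _ hε)
  rw [mem_map, Metric.mem_nhdsWithin_iff] at h
  obtain ⟨δ, hδ, h⟩ := h
  have hy : max s (u - δ) < u := max_lt hu.1 (by linarith)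
  filter_upwards [Ioo_mem_nhdsLT hy] with v hv
  have hv' : v ∈ Ico s r := ⟨(le_max_left _ _).trans hv.1.le, hv.2.trans_le hu.2⟩
  refine rightReg_mem_of_forall (x := v) (y := u) Metric.isClosed_closedBall hQ hv'
    (hr v hv') le_rfl hv.2 ?_
  intro q hq h1 h2
  refine h ⟨?_, hq, h2⟩
  rw [Metric.mem_ball, Real.dist_eq, abs_sub_comm, abs_of_pos (sub_pos.2 h2)]
  have := (le_max_right s (u - δ)).trans_lt hv.1
  linarith

/-- `f` makes at least `k` successive upcrossings of `[a,b]` along points of `Q ∩ (x,y)`. -/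
def HasUpcrossings (Q : Set ℝ) (f : ℝ → ℝ) (a b y : ℝ) : ℕ → ℝ → Prop
  | 0, _ => True
  | k + 1, x => ∃ p ∈ Q, ∃ q ∈ Q, x < p ∧ p < q ∧ q < y ∧ f p < a ∧ b < f q ∧
      HasUpcrossings Q f a b y k q

theorem HasUpcrossings.mono {Q : Set ℝ} {f : ℝ → ℝ} {a b y x x' : ℝ} {k : ℕ} (hx : x ≤ x')
    (h : HasUpcrossings Q f a b y k x') : HasUpcrossings Q f a b y k x := by
  cases k with
  | zero => trivial
  | succ k =>
    obtain ⟨p, hp, q, hq, h1, h2⟩ := h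
    exact ⟨p, hp, q, hq, hx.trans_lt h1, h2⟩

theorem hasUpcrossings_of_frequently_left {Q : Set ℝ} {f : ℝ → ℝ} {a b u : ℝ}
    (ha : ∃ᶠ q in nhdsWithin u (Q ∩ Iio u), f q < a)
    (hb : ∃ᶠ q in nhdsWithin u (Q ∩ Iio u), b < f q) (k : ℕ) :
    ∀ x < u, HasUpcrossings Q f a b u k x := by
  induction k with
  | zero => exact fun _ _ => trivial
  | succ k ih =>
    intro x hx
    have hgt : ∀ z < u, ∀ᶠ q in nhdsWithin u (Q ∩ Iio u), z < q ∧ q ∈ Q ∩ Iio u := fun z hz =>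
      Filter.inter_mem (mem_nhdsWithin_of_mem_nhds (Ioi_mem_nhds hz)) self_mem_nhdsWithin
    obtain ⟨p, hp1, hp2, hp3⟩ := (ha.and_eventually (hgt x hx)).exists
    obtain ⟨q, hq1, hq2, hq3⟩ := (hb.and_eventually (hgt p hp3.2)).exists
    exact ⟨p, hp3.1, q, hq3.1, hp2, hq2, hq3.2, hp1, hq1, ih q hq3.2⟩

theorem hasUpcrossings_of_frequently_right {Q : Set ℝ} {f : ℝ → ℝ} {a b u y : ℝ} (hy : u < y)
    (ha : ∃ᶠ q in nhdsWithin u (Q ∩ Ioi u), f q < a)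
    (hb : ∃ᶠ q in nhdsWithin u (Q ∩ Ioi u), b < f q) (k : ℕ) :
    ∃ x, u < x ∧ x < y ∧ HasUpcrossings Q f a b y k x := by
  induction k with
  | zero =>
    obtain ⟨x, hx⟩ := exists_between hy
    exact ⟨x, hx.1, hx.2, trivial⟩
  | succ k ih =>
    obtain ⟨x, hx, hxy, hk⟩ := ih
    have hlt : ∀ z, u < z → ∀ᶠ q in nhdsWithin u (Q ∩ Ioi u), q < z ∧ q ∈ Q ∩ Ioi u :=
      fun z hz => Filter.inter_mem (mem_nhdsWithin_of_mem_nhds (Iio_mem_nhds hz)) self_mem_nhdsWithin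
    obtain ⟨q, hq1, hq2, hq3⟩ := (hb.and_eventually (hlt x hx)).exists
    obtain ⟨p, hp1, hp2, hp3⟩ := (ha.and_eventually (hlt q hq3.2)).exists
    obtain ⟨z, hz⟩ := exists_between (show u < p from hp3.2)
    exact ⟨z, hz.1, hz.2.trans (hp2.trans (hq2.trans hxy)), p, hp3.1, q, hq3.1, hz.2, hp2,
      hq2.trans hxy, hp1, hq1, hk.mono hq2.le⟩

/-- A process sampled along the dyadic grid of level `n` on `[s,r]`. -/
noncomputable def gridProc (s r : ℝ) (U : ℝ → Ω → ℝ) (n i : ℕ) : Ω → ℝ :=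
  U (gridPt s r n (min i (2 ^ n)))

theorem HasUpcrossings.eventually_le {s r : ℝ} (hsr : s < r) (U : ℝ → Ω → ℝ) (ω : Ω)
    {a b y : ℝ} (hab : a < b) {k : ℕ} : ∀ {x : ℝ},
    HasUpcrossings (gridSet s r) (fun u => U u ω) a b y k x →
    ∀ᶠ n in atTop, ∀ N ≤ 2 ^ n + 1, (∀ i ≤ 2 ^ n, x < gridPt s r n i → N ≤ i) →
      upcrossingsBefore a b (gridProc s r U n) N ω + k ≤
        upcrossingsBefore a b (gridProc s r U n) (2 ^ n + 1) ω := by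
  induction k with
  | zero =>
    intro x _
    refine Eventually.of_forall fun n N hN _ => ?_
    exact upcrossingsBefore_mono hab hN ω
  | succ k ih =>
    rintro x ⟨p, hp, q, hq, hxp, hpq, -, hpa, hqb, hk⟩
    filter_upwards [eventually_gridPt_of_mem hp, eventually_gridPt_of_mem hq, ih hk] with n h1 h2 h3
    obtain ⟨N₁, hN₁, rfl⟩ := h1
    obtain ⟨N₂, hN₂, rfl⟩ := h2
    intro N hN hNi
    have hlt := upcrossingsBefore_lt_of_exists_upcrossing (f := gridProc s r U n) (ω := ω) hab
      (hNi N₁ hN₁ hxp)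
      (by simpa only [gridProc, min_eq_left hN₁] using hpa)
      ((gridPt_lt_iff hsr n _ _).1 hpq).le
      (by simpa only [gridProc, min_eq_left hN₂] using hqb)
    have := h3 (N₂ + 1) (Nat.add_le_add_right hN₂ 1)
      (fun i _ hi => (gridPt_lt_iff hsr n _ _).1 hi)
    omega

/-- A nonpositive submartingale has only finitely many upcrossings along a dyadic grid. -/
theorem ae_not_hasUpcrossings {m0 : MeasurableSpace Ω} {μ : Measure Ω} [IsProbabilityMeasure μ]
    (ℱ : Filtration ℝ m0) {s r : ℝ} (hsr : s < r) (U : ℝ → Ω → ℝ)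
    (hUm : ∀ u ∈ Icc s r, StronglyMeasurable[ℱ u] (U u))
    (hUi : ∀ u ∈ Icc s r, Integrable (U u) μ)
    (hU0 : ∀ u ∈ Icc s r, U u ≤ᵐ[μ] 0)
    (hUs : ∀ u ∈ Icc s r, ∀ v ∈ Icc s r, u ≤ v → U u ≤ᵐ[μ] μ[U v | ℱ u])
    {a b : ℝ} (hab : a < b) :
    ∀ᵐ ω ∂μ, ∃ K, ∀ x y, ¬ HasUpcrossings (gridSet s r) (fun u => U u ω) a b y K x := by
  have hgm : ∀ n i, gridPt s r n (min i (2 ^ n)) ∈ Icc s r :=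
    fun n i => gridPt_mem hsr (min_le_right _ _)
  let 𝒢 : ℕ → Filtration ℕ m0 := fun n =>
    { seq := fun i => ℱ (gridPt s r n (min i (2 ^ n)))
      mono' := fun i j hij => ℱ.mono (gridPt_mono hsr n (min_le_min_right _ hij))
      le' := fun i => ℱ.le _ }
  have hsub : ∀ n, Submartingale (gridProc s r U n) (𝒢 n) μ := fun n =>
    ⟨fun i => hUm _ (hgm n i), fun i j hij => hUs _ (hgm n i) _ (hgm n j)
      (gridPt_mono hsr n (min_le_min_right _ hij)), fun i => hUi _ (hgm n i)⟩
  let cnt : ℕ → Ω → ℕ := fun n ω => upcrossingsBefore a b (gridProc s r U n) (2 ^ n + 1) ω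
  have hcm : ∀ n, Measurable fun ω => (cnt n ω : ℝ≥0∞) := fun n =>
    measurable_from_top.comp ((hsub n).stronglyAdapted.measurable_upcrossingsBefore hab)
  have hbound : ∀ n, ∫⁻ ω, (cnt n ω : ℝ≥0∞) ∂μ ≤ ENNReal.ofReal (|a| / (b - a)) := by
    intro n
    have h1 := (hsub n).mul_integral_upcrossingsBefore_le_integral_pos_part a b (2 ^ n + 1)
    have hInt : Integrable (fun ω => (cnt n ω : ℝ)) μ :=
      (hsub n).stronglyAdapted.integrable_upcrossingsBefore hab
    have h2 : ∫ ω, (gridProc s r U n (2 ^ n + 1) ω - a)⁺ ∂μ ≤ |a| := by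
      have : ∫ _ : Ω, |a| ∂μ = |a| := by simp
      rw [← this]
      refine integral_mono_of_nonneg (ae_of_all _ fun ω => posPart_nonneg _)
        (integrable_const _) ?_
      filter_upwards [hU0 _ (hgm n (2 ^ n + 1))] with ω hω
      have hω : gridProc s r U n (2 ^ n + 1) ω ≤ 0 := hω
      refine sup_le ?_ (abs_nonneg _)
      linarith [neg_abs_le a]
    have h3 : ∫ ω, (cnt n ω : ℝ) ∂μ ≤ |a| / (b - a) := by
      rw [le_div_iff₀ (sub_pos.2 hab), mul_comm]
      exact h1.trans h2
    calc ∫⁻ ω, (cnt n ω : ℝ≥0∞) ∂μ = ∫⁻ ω, ENNReal.ofReal (cnt n ω : ℝ) ∂μ := by simp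
      _ = ENNReal.ofReal (∫ ω, (cnt n ω : ℝ) ∂μ) :=
        (ofReal_integral_eq_lintegral_ofReal hInt (ae_of_all _ fun ω => Nat.cast_nonneg _)).symm
      _ ≤ _ := ENNReal.ofReal_le_ofReal h3
  have hfat : ∫⁻ ω, liminf (fun n => (cnt n ω : ℝ≥0∞)) atTop ∂μ < ∞ := by
    refine (lintegral_liminf_le hcm).trans_lt
      (lt_of_le_of_lt (b := ENNReal.ofReal (|a| / (b - a))) ?_ ENNReal.ofReal_lt_top)
    exact (liminf_le_liminf (Eventually.of_forall hbound)).trans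
      (liminf_const (ENNReal.ofReal (|a| / (b - a)))).le
  filter_upwards [ae_lt_top (Measurable.liminf hcm) hfat.ne] with ω hω
  obtain ⟨K, hK⟩ := ENNReal.exists_nat_gt hω.ne
  refine ⟨K, fun x y hup => ?_⟩
  have hev := hup.eventually_le hsr U ω hab
  refine absurd hK (not_lt.2 ?_)
  refine le_liminf_of_le (by isBoundedDefault) ?_
  filter_upwards [hev] with n hn
  have := hn 0 (Nat.zero_le _) (fun i _ _ => Nat.zero_le i)
  rw [upcrossingsBefore_zero, zero_add] at this
  exact_mod_cast this

/-- A nonnegative supermartingale that is a.s. positive at `r` is bounded away from zero along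
the dyadic grid of `[s,r]`. -/
theorem ae_exists_pos_le_gridSet {m0 : MeasurableSpace Ω} {μ : Measure Ω} [IsProbabilityMeasure μ]
    (ℱ : Filtration ℝ m0) {s r : ℝ} (hsr : s < r) (X : ℝ → Ω → ℝ)
    (hXm : ∀ u ∈ Icc s r, StronglyMeasurable[ℱ u] (X u))
    (hXi : ∀ u ∈ Icc s r, Integrable (X u) μ)
    (hXs : ∀ u ∈ Icc s r, μ[X r | ℱ u] ≤ᵐ[μ] X u)
    (hXr : ∀ᵐ ω ∂μ, 0 < X r ω) :
    ∀ᵐ ω ∂μ, ∃ ε > 0, ∀ q ∈ gridSet s r, ε ≤ X q ω := by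
  have hrm : r ∈ Icc s r := right_mem_Icc.2 hsr.le
  let E : ℝ → ℕ → ℕ → Set Ω := fun ε n N => {ω | ∃ i < N, X (gridPt s r n i) ω < ε}
  have hEsucc : ∀ ε n N, E ε n (N + 1) =
      E ε n N ∪ ({ω | X (gridPt s r n N) ω < ε} \ E ε n N) := by
    intro ε n N
    ext ω
    simp only [E, mem_ofPred_eq, mem_union, Set.mem_sdiff, Nat.lt_succ_iff_lt_or_eq]
    constructor
    · rintro ⟨i, hi | rfl, h⟩
      · exact Or.inl ⟨i, hi, h⟩
      · by_cases h' : ∃ j < i, X (gridPt s r n j) ω < ε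
        · exact Or.inl h'
        · exact Or.inr ⟨h, h'⟩
    · rintro (⟨i, hi, h⟩ | ⟨h, -⟩)
      · exact ⟨i, Or.inl hi, h⟩
      · exact ⟨N, Or.inr rfl, h⟩
  have hEm : ∀ ε n N, ∀ M ≤ 2 ^ n, N ≤ M + 1 → MeasurableSet[ℱ (gridPt s r n M)] (E ε n N) := by
    intro ε n N M hM hNM
    have : E ε n N = ⋃ i ∈ Finset.range N, {ω | X (gridPt s r n i) ω < ε} := by
      ext ω; simp [E]
    rw [this]
    refine Finset.measurableSet_biUnion _ fun i hi => ?_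
    have hiM : i ≤ M := Nat.lt_succ_iff.1 ((Finset.mem_range.1 hi).trans_le hNM)
    have := (hXm _ (gridPt_mem hsr (hiM.trans hM))).measurable (measurableSet_Iio (a := ε))
    exact ℱ.mono (gridPt_mono hsr n hiM) _ this
  have hEm0 : ∀ ε n N, N ≤ 2 ^ n + 1 → MeasurableSet (E ε n N) := fun ε n N hN =>
    ℱ.le _ _ (hEm ε n N (2 ^ n) le_rfl hN)
  have hmax : ∀ ε n N, N ≤ 2 ^ n + 1 → ∫ ω in E ε n N, X r ω ∂μ ≤ ε * μ.real (E ε n N) := by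
    intro ε n N
    induction N with
    | zero => intro _; simp [E]
    | succ N ih =>
      intro hN
      have hN' : N ≤ 2 ^ n := by omega
      have hqm := gridPt_mem hsr hN'
      have hSm : MeasurableSet[ℱ (gridPt s r n N)] {ω | X (gridPt s r n N) ω < ε} :=
        (hXm _ hqm).measurable measurableSet_Iio
      have hFm := hSm.diff (hEm ε n N N hN' (Nat.le_succ N))
      have hdisj : Disjoint (E ε n N) ({ω | X (gridPt s r n N) ω < ε} \ E ε n N) :=
        disjoint_sdiff_right
      rw [hEsucc, setIntegral_union hdisj (ℱ.le _ _ hFm) (hXi r hrm).integrableOn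
        (hXi r hrm).integrableOn, measureReal_union hdisj (ℱ.le _ _ hFm), mul_add]
      refine add_le_add (ih (by omega)) ?_
      refine (setIntegral_le_of_condExp_le (ℱ.le _) (hXi r hrm) (hXi _ hqm) (hXs _ hqm) hFm).trans ?_
      refine (setIntegral_mono_on (hXi _ hqm).integrableOn (integrableOn_const)
        (ℱ.le _ _ hFm) (g := fun _ => ε) fun ω hω => (le_of_lt hω.1)).trans ?_
      rw [setIntegral_const, smul_eq_mul, mul_comm]
  let B : ℝ → Set Ω := fun ε => ⋃ n, E ε n (2 ^ n + 1)
  have hBm : ∀ ε, MeasurableSet (B ε) := fun ε => MeasurableSet.iUnion fun n => hEm0 ε n _ le_rfl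
  have hBint : ∀ ε, 0 ≤ ε → ∫ ω in B ε, X r ω ∂μ ≤ ε := by
    intro ε hε
    refine le_of_tendsto' (tendsto_setIntegral_of_monotone (fun n => hEm0 ε n _ le_rfl) ?_
      (hXi r hrm).integrableOn) fun n => (hmax ε n _ le_rfl).trans ?_
    · refine monotone_nat_of_le_succ fun n => ?_
      rintro ω ⟨i, hi, h⟩
      refine ⟨i * 2 ^ 1, ?_, by rwa [gridPt_refine s r n 1 i] at h⟩
      rw [pow_succ]; omega
    · exact mul_le_of_le_one_right hε measureReal_le_one
  have hXr0 : 0 ≤ᵐ[μ] X r := hXr.mono fun ω h => h.le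
  have hBB : ∫ ω in ⋂ k : ℕ, B (1 / ((k : ℝ) + 1)), X r ω ∂μ ≤ 0 := by
    refine ge_of_tendsto' (tendsto_one_div_add_atTop_nhds_zero_nat (𝕜 := ℝ)) fun k => ?_
    refine le_trans ?_ (hBint (1 / ((k : ℝ) + 1)) (by positivity))
    exact setIntegral_mono_set (hXi r hrm).integrableOn (ae_restrict_of_ae hXr0)
      (LE.le.eventuallyLE (iInter_subset _ k))
  have hBBm : MeasurableSet (⋂ k : ℕ, B (1 / ((k : ℝ) + 1))) := MeasurableSet.iInter fun k => hBm _
  have hz : ∀ᵐ ω ∂μ, ω ∉ ⋂ k : ℕ, B (1 / ((k : ℝ) + 1)) := by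
    have h0 : ∫ ω in ⋂ k : ℕ, B (1 / ((k : ℝ) + 1)), X r ω ∂μ = 0 :=
      le_antisymm hBB (integral_nonneg_of_ae (ae_restrict_of_ae hXr0))
    rw [setIntegral_eq_zero_iff_of_nonneg_ae (ae_restrict_of_ae hXr0)
      (hXi r hrm).integrableOn] at h0
    have h0 := (ae_restrict_iff' hBBm).1 h0
    filter_upwards [h0, hXr] with ω h1 h2 h3
    have : X r ω = 0 := h1 h3
    exact h2.ne' this
  filter_upwards [hz] with ω hω
  rw [mem_iInter, not_forall] at hω
  obtain ⟨k, hk⟩ := hω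
  refine ⟨1 / ((k : ℝ) + 1), by positivity, ?_⟩
  rintro _ ⟨n, i, hi, rfl⟩
  by_contra hlt
  exact hk (mem_iUnion.2 ⟨n, i, Nat.lt_succ_iff.2 hi, not_le.1 hlt⟩)

theorem exists_tendsto_of_no_upcrossings_mul {l : Filter ℝ} {x φ : ℝ → ℝ} {ℓ ε N : ℝ}
    (hx : Tendsto x l (nhds ℓ)) (hε : 0 < ε) (hxε : ∀ᶠ q in l, ε ≤ x q)
    (hφ0 : ∀ q, 0 ≤ φ q) (hφN : ∀ q, φ q ≤ N)
    (h : ∀ a b : ℚ, a < b → ¬((∃ᶠ q in l, -(x q * φ q) < (a : ℝ)) ∧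
      ∃ᶠ q in l, (b : ℝ) < -(x q * φ q))) :
    ∃ L, Tendsto φ l (nhds L) := by
  rcases l.eq_or_neBot with rfl | hl
  · exact ⟨0, tendsto_bot⟩
  have hℓ : ε ≤ ℓ := ge_of_tendsto hx hxε
  have hx1 : ∀ᶠ q in l, x q < ℓ + 1 := hx.eventually_lt_const (lt_add_one ℓ)
  obtain ⟨c, hc⟩ := tendsto_of_no_upcrossings (f := l) (u := fun q => -(x q * φ q))
    (s := range ((↑) : ℚ → ℝ)) Rat.denseRange_cast (by
      rintro _ ⟨a, rfl⟩ _ ⟨b, rfl⟩ hab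
      exact h a b (by exact_mod_cast hab))
    ⟨0, by
      rw [eventually_map]
      filter_upwards [hxε] with q hq
      have := mul_nonneg (hε.le.trans hq) (hφ0 q)
      linarith⟩
    ⟨-((ℓ + 1) * N), by
      rw [eventually_map]
      filter_upwards [hxε, hx1] with q hq hq1
      exact neg_le_neg (mul_le_mul hq1.le (hφN q) (hφ0 q) (by linarith))⟩
  refine ⟨-c / ℓ, (hc.neg.div hx (by linarith)).congr' ?_⟩
  filter_upwards [hxε] with q hq
  have : x q ≠ 0 := by linarith
  simp only [Pi.div_apply, neg_neg]
  field_simp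

/-- Regularity of a bounded process `φ` along the dyadic grid when `X φ` is a supermartingale for
some positive càdlàg supermartingale `X`. -/
theorem ae_exists_tendsto_gridSet {m0 : MeasurableSpace Ω} {μ : Measure Ω} [IsProbabilityMeasure μ]
    (ℱ : Filtration ℝ m0) {T s r : ℝ} (hs : 0 ≤ s) (hsr : s < r) (hrT : r ≤ T) (X : ℝ → Ω → ℝ)
    (hX : SuperMG μ T ℱ X) (hXr : ∀ᵐ ω ∂μ, 0 < X r ω) (φ : ℝ → Ω → ℝ) (N : ℝ)
    (hφm : ∀ u ∈ Icc s r, StronglyMeasurable[ℱ u] (φ u))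
    (hφ0 : ∀ u ω, 0 ≤ φ u ω) (hφN : ∀ u ω, φ u ω ≤ N)
    (hφs : ∀ u ∈ Icc s r, ∀ v ∈ Icc s r, u ≤ v →
      μ[fun ω => X v ω * φ v ω | ℱ u] ≤ᵐ[μ] fun ω => X u ω * φ u ω) :
    ∀ᵐ ω ∂μ,
      (∀ u ∈ Ico s r, ∃ L, Tendsto (fun q => φ q ω)
        (nhdsWithin u (gridSet s r ∩ Ioi u)) (nhds L)) ∧
      (∀ u ∈ Ioc s r, ∃ L, Tendsto (fun q => φ q ω)
        (nhdsWithin u (gridSet s r ∩ Iio u)) (nhds L)) := by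
  have hmem : ∀ u ∈ Icc s r, u ∈ Icc 0 T := fun u hu => ⟨hs.trans hu.1, hu.2.trans hrT⟩
  have hrm : r ∈ Icc s r := right_mem_Icc.2 hsr.le
  have hInt : ∀ u ∈ Icc s r, Integrable (fun ω => X u ω * φ u ω) μ := by
    intro u hu
    refine (hX.2.1 u (hmem u hu)).mul_bdd (c := N) ((hφm u hu).mono (ℱ.le u)).aestronglyMeasurable
      (ae_of_all _ fun ω => ?_)
    rw [Real.norm_of_nonneg (hφ0 u ω)]; exact hφN u ω
  have hup : ∀ᵐ ω ∂μ, ∀ a b : ℚ, a < b → ∃ K, ∀ x y,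
      ¬ HasUpcrossings (gridSet s r) (fun u => -(X u ω * φ u ω)) a b y K x := by
    rw [ae_all_iff]; intro a
    rw [ae_all_iff]; intro b
    by_cases hab : a < b
    · have := ae_not_hasUpcrossings (μ := μ) ℱ hsr (fun u ω => -(X u ω * φ u ω)) ?_ ?_ ?_ ?_
        (show (a : ℝ) < b by exact_mod_cast hab)
      · filter_upwards [this] with ω hω _ using hω
      · exact fun u hu => ((hX.1.1 u (hmem u hu)).mul (hφm u hu)).neg
      · exact fun u hu => (hInt u hu).neg
      · intro u hu
        filter_upwards [hX.1.2.1] with ω hω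
        exact neg_nonpos.2 (mul_nonneg (hω u (hmem u hu)) (hφ0 u ω))
      · intro u hu v hv huv
        have he : μ[fun ω => -(X v ω * φ v ω) | ℱ u] =ᵐ[μ] -μ[fun ω => X v ω * φ v ω | ℱ u] :=
          condExp_neg _ _
        filter_upwards [he, hφs u hu v hv huv] with ω h1 h2
        rw [h1, Pi.neg_apply]
        exact neg_le_neg h2
    · exact ae_of_all _ fun ω h => absurd h hab
  have hpos := ae_exists_pos_le_gridSet (μ := μ) ℱ hsr X (fun u hu => hX.1.1 u (hmem u hu))
    (fun u hu => hX.2.1 u (hmem u hu))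
    (fun u hu => hX.2.2 u r (hmem u hu) (hmem r hrm) hu.2) hXr
  filter_upwards [hup, hpos, hX.1.2.2] with ω h1 h2 h3
  obtain ⟨ε, hε, h2⟩ := h2
  have hQ : ∀ (u : ℝ) (S : Set ℝ), ∀ᶠ q in nhdsWithin u (gridSet s r ∩ S), ε ≤ X q ω :=
    fun u S => by
      filter_upwards [self_mem_nhdsWithin] with q hq using h2 q hq.1
  constructor
  · intro u hu
    refine exists_tendsto_of_no_upcrossings_mul (x := fun q => X q ω) (ℓ := X u ω) ?_ hε (hQ u _)
      (fun q => hφ0 q ω) (fun q => hφN q ω) ?_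
    · exact (h3.1 u ⟨hs.trans hu.1, hu.2.trans_le hrT⟩).mono_left
        (nhdsWithin_mono _ inter_subset_right)
    · rintro a b hab ⟨ha, hb⟩
      obtain ⟨K, hK⟩ := h1 a b hab
      obtain ⟨x, -, -, hx⟩ := hasUpcrossings_of_frequently_right hu.2 ha hb K
      exact hK x r hx
  · intro u hu
    obtain ⟨ℓ, hℓ⟩ := h3.2 u ⟨hs.trans_lt hu.1, hu.2.trans hrT⟩
    refine exists_tendsto_of_no_upcrossings_mul (x := fun q => X q ω) (ℓ := ℓ) ?_ hε (hQ u _)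
      (fun q => hφ0 q ω) (fun q => hφN q ω) ?_
    · exact hℓ.mono_left (nhdsWithin_mono _ inter_subset_right)
    · rintro a b hab ⟨ha, hb⟩
      obtain ⟨K, hK⟩ := h1 a b hab
      exact hK s u (hasUpcrossings_of_frequently_left ha hb K s hu.1)

theorem stronglyMeasurable_div_real {m : MeasurableSpace Ω} {f g : Ω → ℝ}
    (hf : StronglyMeasurable[m] f) (hg : StronglyMeasurable[m] g) :
    StronglyMeasurable[m] fun ω => f ω / g ω :=
  (hf.measurable.div hg.measurable).stronglyMeasurable

theorem stronglyMeasurable_clamp {m : MeasurableSpace Ω} {f : Ω → ℝ} (N : ℝ)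
    (hf : StronglyMeasurable[m] f) : StronglyMeasurable[m] fun ω => max 0 (min N (f ω)) :=
  (measurable_const.max (measurable_const.min hf.measurable)).stronglyMeasurable

theorem SuperMG.ae_nonneg {m0 : MeasurableSpace Ω} {μ : Measure Ω} {T : ℝ} {ℱ : Filtration ℝ m0}
    {X : ℝ → Ω → ℝ} (hX : SuperMG μ T ℱ X) {t : ℝ} (ht : t ∈ Icc 0 T) : 0 ≤ᵐ[μ] X t :=
  hX.1.2.1.mono fun _ h => h t ht

theorem SuperMG.ae_eq_zero_of_eq_zero {m0 : MeasurableSpace Ω} {μ : Measure Ω}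
    [IsProbabilityMeasure μ] {T : ℝ} {ℱ : Filtration ℝ m0} {X : ℝ → Ω → ℝ}
    (hX : SuperMG μ T ℱ X) {s t : ℝ} (hs : s ∈ Icc 0 T) (ht : t ∈ Icc 0 T) (hst : s ≤ t) :
    ∀ᵐ ω ∂μ, X s ω = 0 → X t ω = 0 := by
  have hA : MeasurableSet[ℱ s] {ω | X s ω = 0} :=
    (hX.1.1 s hs).measurable (measurableSet_singleton (0 : ℝ))
  have h1 := setIntegral_le_of_condExp_le (ℱ.le s) (hX.2.1 t ht) (hX.2.1 s hs)
    (hX.2.2 s t hs ht hst) hA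
  rw [setIntegral_congr_fun (g := fun _ => (0 : ℝ)) (ℱ.le s _ hA) (fun ω hω => hω),
    integral_zero] at h1
  have h2 := le_antisymm h1 (integral_nonneg_of_ae (ae_restrict_of_ae (hX.ae_nonneg ht)))
  rw [setIntegral_eq_zero_iff_of_nonneg_ae (ae_restrict_of_ae (hX.ae_nonneg ht))
    (hX.2.1 t ht).integrableOn] at h2
  exact (ae_restrict_iff' (ℱ.le s _ hA)).1 h2

theorem SuperMG.ae_pos_of_ae_pos {m0 : MeasurableSpace Ω} {μ : Measure Ω}
    [IsProbabilityMeasure μ] {T : ℝ} {ℱ : Filtration ℝ m0} {X : ℝ → Ω → ℝ}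
    (hX : SuperMG μ T ℱ X) {s t : ℝ} (hs : s ∈ Icc 0 T) (ht : t ∈ Icc 0 T) (hst : s ≤ t)
    (hpos : ∀ᵐ ω ∂μ, 0 < X t ω) : ∀ᵐ ω ∂μ, 0 < X s ω := by
  filter_upwards [hX.ae_eq_zero_of_eq_zero hs ht hst, hX.ae_nonneg hs, hpos] with ω h1 h2 h3
  exact lt_of_le_of_ne h2 fun h => h3.ne' (h1 h.symm)

theorem CadlagOn.ite {T r : ℝ} {f₁ f₂ : ℝ → ℝ} (h₁ : CadlagOn r f₁)
    (h₂r : ∀ t ∈ Ico r T, Tendsto f₂ (nhdsWithin t (Ioi t)) (nhds (f₂ t)))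
    (h₂l : ∀ t ∈ Ioc r T, ∃ L, Tendsto f₂ (nhdsWithin t (Iio t)) (nhds L)) :
    CadlagOn T (fun t => if t < r then f₁ t else f₂ t) := by
  constructor
  · intro t ht
    by_cases htr : t < r
    · simp only [htr, if_true]
      refine (h₁.1 t ⟨ht.1, htr⟩).congr' ?_
      filter_upwards [nhdsWithin_le_nhds (Iio_mem_nhds htr)] with u hu
      rw [if_pos (mem_Iio.1 hu)]
    · simp only [htr, if_false]
      refine (h₂r t ⟨not_lt.1 htr, ht.2⟩).congr' ?_
      filter_upwards [self_mem_nhdsWithin] with u hu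
      rw [if_neg (not_lt.2 ((not_lt.1 htr).trans (le_of_lt hu)))]
  · intro t ht
    by_cases htr : t ≤ r
    · obtain ⟨L, hL⟩ := h₁.2 t ⟨ht.1, htr⟩
      refine ⟨L, hL.congr' ?_⟩
      filter_upwards [self_mem_nhdsWithin] with u hu
      rw [if_pos (lt_of_lt_of_le hu htr)]
    · obtain ⟨L, hL⟩ := h₂l t ⟨not_le.1 htr, ht.2⟩
      refine ⟨L, hL.congr' ?_⟩
      filter_upwards [nhdsWithin_le_nhds (Ioi_mem_nhds (not_le.1 htr))] with u hu
      rw [if_neg (not_lt.2 (le_of_lt hu))]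

theorem cadlagOn_const (T c : ℝ) : CadlagOn T (fun _ => c) :=
  ⟨fun _ _ => tendsto_const_nhds, fun _ _ => ⟨c, tendsto_const_nhds⟩⟩

theorem CadlagOn.mul {T : ℝ} {f₁ f₂ : ℝ → ℝ} (h₁ : CadlagOn T f₁) (h₂ : CadlagOn T f₂) :
    CadlagOn T (fun t => f₁ t * f₂ t) :=
  ⟨fun t ht => (h₁.1 t ht).mul (h₂.1 t ht), fun t ht => by
    obtain ⟨L, hL⟩ := h₁.2 t ht
    obtain ⟨M, hM⟩ := h₂.2 t ht
    exact ⟨L * M, hL.mul hM⟩⟩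

/-- The sets of processes competing in the definition of the solid, fork-convex hull. -/
structure SolidFork {m0 : MeasurableSpace Ω} (μ : Measure Ω) (T : ℝ)
    (ℱ : Filtration ℝ m0) (H : Set (ℝ → Ω → ℝ)) : Prop where
  sub : ∀ X ∈ H, S1mem μ T ℱ X
  solid : ProcSolid μ T ℱ H
  fork : ForkConvex μ T ℱ H

theorem SolidFork.superMG {m0 : MeasurableSpace Ω} {μ : Measure Ω} {T : ℝ}
    {ℱ : Filtration ℝ m0} {H : Set (ℝ → Ω → ℝ)} (hH : SolidFork μ T ℱ H)
    {X : ℝ → Ω → ℝ} (hX : X ∈ H) : SuperMG μ T ℱ X := (hH.sub X hX).1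

theorem SolidFork.exists_fork {m0 : MeasurableSpace Ω} {μ : Measure Ω} {T : ℝ}
    {ℱ : Filtration ℝ m0} {H : Set (ℝ → Ω → ℝ)} (hH : SolidFork μ T ℱ H) {s : ℝ}
    (hs : s ∈ Icc 0 T) {h : Ω → ℝ} (hm : StronglyMeasurable[ℱ s] h) (h0 : ∀ ω, 0 ≤ h ω)
    (h1 : ∀ ω, h ω ≤ 1) {X Y₁ Y₂ : ℝ → Ω → ℝ} (hX : X ∈ H) (hY₁ : Y₁ ∈ H) (hY₂ : Y₂ ∈ H) :
    ∃ Z ∈ H, (∀ t < s, Z t = X t) ∧ ∀ t, s ≤ t → ∀ ω,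
      Z t ω = X s ω * (h ω * (Y₁ t ω / Y₁ s ω) + (1 - h ω) * (Y₂ t ω / Y₂ s ω)) := by
  refine ⟨_, hH.fork s hs h hm h0 h1 X hX Y₁ hY₁ Y₂ hY₂, fun t ht => ?_, fun t ht ω => ?_⟩
  · ext ω; rw [if_pos ht]
  · rw [if_neg (not_lt.2 ht)]

theorem SolidFork.exists_paste {m0 : MeasurableSpace Ω} {μ : Measure Ω} {T : ℝ}
    {ℱ : Filtration ℝ m0} {H : Set (ℝ → Ω → ℝ)} (hH : SolidFork μ T ℱ H) {s : ℝ}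
    (hs : s ∈ Icc 0 T) {X Y : ℝ → Ω → ℝ} (hX : X ∈ H) (hY : Y ∈ H) :
    ∃ Z ∈ H, (∀ t < s, Z t = X t) ∧ ∀ t, s ≤ t → ∀ ω, Z t ω = X s ω * (Y t ω / Y s ω) := by
  obtain ⟨Z, hZ, h1, h2⟩ := hH.exists_fork hs (h := fun _ => 1) stronglyMeasurable_const
    (fun _ => zero_le_one) (fun _ => le_rfl) hX hY hY
  exact ⟨Z, hZ, h1, fun t ht ω => by rw [h2 t ht ω]; ring⟩

theorem SolidFork.exists_mul_from {m0 : MeasurableSpace Ω} {μ : Measure Ω} {T : ℝ}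
    {ℱ : Filtration ℝ m0} {H : Set (ℝ → Ω → ℝ)} (hH : SolidFork μ T ℱ H) {r : ℝ}
    {η : Ω → ℝ} (hm : StronglyMeasurable[ℱ r] η) (h0 : ∀ ω, 0 ≤ η ω)
    (h1 : ∀ ω, η ω ≤ 1) {X : ℝ → Ω → ℝ} (hX : X ∈ H) :
    ∃ Z ∈ H, (∀ t < r, Z t = X t) ∧ ∀ t, r ≤ t → ∀ ω, Z t ω = X t ω * η ω := by
  have hV : Vmem μ T ℱ (fun t ω => if t < r then 1 else η ω) := by
    refine ⟨⟨fun t _ => ?_, ae_of_all _ fun ω t _ => ?_, ae_of_all _ fun ω => ?_⟩,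
      ae_of_all _ fun ω s _ t _ hst => ?_, ae_of_all _ fun ω => ?_⟩
    · by_cases htr : t < r
      · simp only [htr, if_true]; exact stronglyMeasurable_const
      · simp only [htr, if_false]; exact hm.mono (ℱ.mono (not_lt.1 htr))
    · dsimp only; split_ifs
      · exact zero_le_one
      · exact h0 ω
    · exact (cadlagOn_const r 1).ite (fun _ _ => tendsto_const_nhds)
        (fun _ _ => ⟨_, tendsto_const_nhds⟩)
    · by_cases htr : t < r
      · simp [htr, hst.trans_lt htr]
      · simp only [htr, if_false]; split_ifs
        · exact h1 ω
        · exact le_rfl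
    · dsimp only; split_ifs
      · exact le_rfl
      · exact h1 ω
  refine ⟨_, hH.solid X hX _ hV, fun t ht => ?_, fun t ht ω => ?_⟩
  · ext ω; rw [if_pos ht, mul_one]
  · rw [if_neg (not_lt.2 ht)]

/-- The conditional optimal value `φ` of `X ↦ X_r g` at time `u`, per unit of `X_u`. -/
theorem SolidFork.exists_value {m0 : MeasurableSpace Ω} {μ : Measure Ω} [IsProbabilityMeasure μ]
    {T : ℝ} {ℱ : Filtration ℝ m0} {H : Set (ℝ → Ω → ℝ)} (hH : SolidFork μ T ℱ H)
    {X₀ : ℝ → Ω → ℝ} (hX₀ : X₀ ∈ H) {u r : ℝ} (hu : 0 ≤ u) (hur : u ≤ r) (hrT : r ≤ T)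
    (hpos : ∀ᵐ ω ∂μ, 0 < X₀ r ω) {g : Ω → ℝ} {N : ℝ} (hgm : StronglyMeasurable[ℱ r] g)
    (hg0 : ∀ ω, 0 ≤ g ω) (hgN : ∀ ω, g ω ≤ N) (hN : 0 ≤ N) :
    ∃ φ : Ω → ℝ, StronglyMeasurable[ℱ u] φ ∧ (∀ ω, 0 ≤ φ ω) ∧ (∀ ω, φ ω ≤ N) ∧
      (∀ X ∈ H, μ[fun ω => X r ω * g ω | ℱ u] ≤ᵐ[μ] fun ω => X u ω * φ ω) ∧
      ∃ Xn : ℕ → ℝ → Ω → ℝ, (∀ n, Xn n ∈ H ∧ Xn n u =ᵐ[μ] X₀ u) ∧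
        ∀ᵐ ω ∂μ, Tendsto (fun n => (μ[fun ω => Xn n r ω * g ω | ℱ u]) ω) atTop
          (nhds (X₀ u ω * φ ω)) := by
  have hum : u ∈ Icc 0 T := ⟨hu, hur.trans hrT⟩
  have hrm : r ∈ Icc 0 T := ⟨hu.trans hur, hrT⟩
  have hgm0 := hgm.mono (ℱ.le r)
  have hInt : ∀ X ∈ H, Integrable (fun ω => X r ω * g ω) μ := fun X hX =>
    ((hH.superMG hX).2.1 r hrm).mul_bdd (c := N) hgm0.aestronglyMeasurable
      (ae_of_all _ fun ω => by rw [Real.norm_of_nonneg (hg0 ω)]; exact hgN ω)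
  have hposu : ∀ᵐ ω ∂μ, 0 < X₀ u ω := (hH.superMG hX₀).ae_pos_of_ae_pos hum hrm hur hpos
  let ψ : (ℝ → Ω → ℝ) → Ω → ℝ := fun X => μ[fun ω => X r ω * g ω | ℱ u]
  have hψm : ∀ X, StronglyMeasurable[ℱ u] (ψ X) := fun X => stronglyMeasurable_condExp
  have hψ0 : ∀ X ∈ H, 0 ≤ᵐ[μ] ψ X := fun X hX => condExp_nonneg (by
    filter_upwards [(hH.superMG hX).ae_nonneg hrm] with ω h using mul_nonneg h (hg0 ω))
  have hψN : ∀ X ∈ H, ψ X ≤ᵐ[μ] fun ω => N * X u ω := by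
    intro X hX
    have h1 : ψ X ≤ᵐ[μ] μ[fun ω => N * X r ω | ℱ u] :=
      condExp_mono (hInt X hX) (((hH.superMG hX).2.1 r hrm).const_mul N) (by
        filter_upwards [(hH.superMG hX).ae_nonneg hrm] with ω h
        rw [mul_comm]; exact mul_le_mul_of_nonneg_right (hgN ω) h)
    have h2 : μ[fun ω => N * X r ω | ℱ u] =ᵐ[μ] fun ω => N * (μ[X r | ℱ u]) ω :=
      condExp_smul N (X r) (ℱ u)
    filter_upwards [h1, h2, (hH.superMG hX).2.2 u r hum hrm hur] with ω h1 h2 h3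
    exact h1.trans (h2.le.trans (mul_le_mul_of_nonneg_left h3 hN))
  -- The value of a process obtained by mixing at time `u`.
  have hmix : ∀ B, MeasurableSet[ℱ u] B → ∀ Z ∈ H, ∀ X ∈ H, ∀ Y ∈ H,
      (∀ᵐ ω ∂μ, ω ∈ B → Z r ω = X r ω) → (∀ᵐ ω ∂μ, ω ∉ B → Z r ω = Y r ω) →
      ∀ᵐ ω ∂μ, (ω ∈ B → ψ Z ω = ψ X ω) ∧ (ω ∉ B → ψ Z ω = ψ Y ω) := by
    have key : ∀ B, MeasurableSet[ℱ u] B → ∀ Z ∈ H, ∀ X ∈ H,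
        (∀ᵐ ω ∂μ, ω ∈ B → Z r ω = X r ω) → ∀ᵐ ω ∂μ, ω ∈ B → ψ Z ω = ψ X ω := by
      intro B hB Z hZ X hX h
      have h1 := condExp_indicator (m := ℱ u) (hInt Z hZ) hB
      have h2 := condExp_indicator (m := ℱ u) (hInt X hX) hB
      have h3 : μ[B.indicator (fun ω => Z r ω * g ω) | ℱ u]
          =ᵐ[μ] μ[B.indicator (fun ω => X r ω * g ω) | ℱ u] := by
        refine condExp_congr_ae ?_
        filter_upwards [h] with ω hω
        by_cases hB : ω ∈ B
        · simp [hB, hω hB]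
        · simp [hB]
      filter_upwards [h1, h2, h3] with ω h1 h2 h3 hω
      rw [h1, h2, indicator_of_mem hω, indicator_of_mem hω] at h3
      exact h3
    intro B hB Z hZ X hX Y hY h1 h2
    filter_upwards [key B hB Z hZ X hX h1, key Bᶜ hB.compl Z hZ Y hY h2] with ω h1 h2
    exact ⟨h1, h2⟩
  let S : Set (ℝ → Ω → ℝ) := {X | X ∈ H ∧ X u =ᵐ[μ] X₀ u}
  obtain ⟨U, hUm, hU1, x, hxS, hxU⟩ := exists_esssup_of_directed (ℱ.le u) S ⟨X₀, hX₀, ae_eq_rfl⟩ ψ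
    (fun ω => N * X₀ u ω) (((hH.superMG hX₀).2.1 u hum).const_mul N) (fun X _ => hψm X)
    (fun X hX => hψ0 X hX.1) (fun X hX => by
      filter_upwards [hψN X hX.1, hX.2] with ω h1 h2; rw [← h2]; exact h1) (by
      intro X hX Y hY
      have hB : MeasurableSet[ℱ u] {ω | ψ Y ω ≤ ψ X ω} :=
        StronglyMeasurable.measurableSet_le (hψm Y) (hψm X)
      obtain ⟨Z, hZ, -, hZ2⟩ := hH.exists_fork hum
        (h := {ω | ψ Y ω ≤ ψ X ω}.indicator fun _ => 1)
        (stronglyMeasurable_const.indicator hB)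
        (fun ω => indicator_nonneg (fun _ _ => zero_le_one) ω)
        (fun ω => indicator_le' (fun _ _ => le_rfl) (fun _ _ => zero_le_one) ω) hX₀ hX.1 hY.1
      have hc : ∀ᵐ ω ∂μ, (ω ∈ {ω | ψ Y ω ≤ ψ X ω} → ψ Z ω = ψ X ω) ∧
          (ω ∉ {ω | ψ Y ω ≤ ψ X ω} → ψ Z ω = ψ Y ω) := by
        refine hmix _ hB Z hZ X hX.1 Y hY.1 ?_ ?_
        · filter_upwards [hX.2, hposu] with ω h1 h2 h3
          rw [hZ2 r hur ω, indicator_of_mem (s := {ω | ψ Y ω ≤ ψ X ω}) h3, h1]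
          field_simp; ring
        · filter_upwards [hY.2, hposu] with ω h1 h2 h3
          rw [hZ2 r hur ω, indicator_of_notMem (s := {ω | ψ Y ω ≤ ψ X ω}) h3, h1]
          field_simp; ring
      refine ⟨Z, ⟨hZ, ?_⟩, ?_, ?_⟩
      · filter_upwards [hX.2, hY.2, hposu] with ω h1 h2 h3
        rw [hZ2 u le_rfl ω, h1, h2, div_self h3.ne']
        ring
      · filter_upwards [hc] with ω hω
        by_cases h : ψ Y ω ≤ ψ X ω
        · exact (hω.1 h).ge
        · exact (not_le.1 h).le.trans (hω.2 h).ge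
      · filter_upwards [hc] with ω hω
        by_cases h : ψ Y ω ≤ ψ X ω
        · exact h.trans (hω.1 h).ge
        · exact (hω.2 h).ge)
  have hU0 : ∀ᵐ ω ∂μ, 0 ≤ U ω ∧ U ω ≤ N * X₀ u ω := by
    have h1 : ∀ᵐ ω ∂μ, ∀ n, 0 ≤ ψ (x n) ω ∧ ψ (x n) ω ≤ N * X₀ u ω := by
      rw [ae_all_iff]; intro n
      filter_upwards [hψ0 _ (hxS n).1, hψN _ (hxS n).1, (hxS n).2] with ω h1 h2 h3
      exact ⟨h1, h3 ▸ h2⟩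
    filter_upwards [h1, hxU] with ω h1 h2
    exact ⟨ge_of_tendsto' h2 fun n => (h1 n).1, le_of_tendsto' h2 fun n => (h1 n).2⟩
  have hφ : ∀ᵐ ω ∂μ, X₀ u ω * max 0 (min N (U ω / X₀ u ω)) = U ω := by
    filter_upwards [hU0, hposu] with ω h1 h2
    rw [min_eq_right ((div_le_iff₀ h2).2 h1.2), max_eq_right (div_nonneg h1.1 h2.le),
      mul_div_cancel₀ _ h2.ne']
  refine ⟨fun ω => max 0 (min N (U ω / X₀ u ω)), ?_, fun ω => le_max_left _ _,
    fun ω => max_le hN (min_le_left _ _), fun X hX => ?_, x, hxS, ?_⟩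
  · exact stronglyMeasurable_clamp N
      (stronglyMeasurable_div_real hUm ((hH.superMG hX₀).1.1 u hum))
  · have hXm := (hH.superMG hX).1.1 u hum
    have hB : MeasurableSet[ℱ u] {ω | 0 < X u ω} := hXm.measurable measurableSet_Ioi
    obtain ⟨Z, hZ, -, hZ2⟩ := hH.exists_fork hum
      (h := {ω | 0 < X u ω}.indicator fun _ => 1) (stronglyMeasurable_const.indicator hB)
      (fun ω => indicator_nonneg (fun _ _ => zero_le_one) ω)
      (fun ω => indicator_le' (fun _ _ => le_rfl) (fun _ _ => zero_le_one) ω) hX₀ hX hX₀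
    have hZS : Z ∈ S := by
      refine ⟨hZ, ?_⟩
      filter_upwards [hposu] with ω h1
      rw [hZ2 u le_rfl ω]
      by_cases h : 0 < X u ω
      · rw [indicator_of_mem (by exact h), div_self h.ne']; ring
      · rw [indicator_of_notMem (by exact h), div_self h1.ne']; ring
    have hprod : (fun ω => X r ω * g ω) =ᵐ[μ] fun ω => (X u ω / X₀ u ω) * (Z r ω * g ω) := by
      filter_upwards [hposu, (hH.superMG hX).ae_eq_zero_of_eq_zero hum hrm hur,
        (hH.superMG hX).ae_nonneg hum] with ω h1 h2 h3
      rcases (show 0 ≤ X u ω from h3).eq_or_lt with h | h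
      · rw [h2 h.symm, ← h]; simp
      · rw [hZ2 r hur ω, indicator_of_mem (by exact h)]
        field_simp; ring
    have hpull := condExp_mul_of_stronglyMeasurable_left (m := ℱ u) (μ := μ)
      (stronglyMeasurable_div_real hXm ((hH.superMG hX₀).1.1 u hum))
      ((hInt X hX).congr hprod) (hInt Z hZ)
    filter_upwards [hU1 Z hZS, condExp_congr_ae (m := ℱ u) hprod, hpull, hφ,
      (hH.superMG hX).ae_nonneg hum, hposu] with ω h1 h2 h3 h4 h5 h6
    rw [h2]
    have h7 : X u ω * max 0 (min N (U ω / X₀ u ω)) = X u ω / X₀ u ω * U ω := by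
      calc _ = X u ω / X₀ u ω * (X₀ u ω * max 0 (min N (U ω / X₀ u ω))) := by field_simp
        _ = _ := by rw [h4]
    rw [h7]
    refine (le_of_eq h3).trans ?_
    exact mul_le_mul_of_nonneg_left h1 (div_nonneg h5 h6.le)
  · filter_upwards [hxU, hφ] with ω h1 h2
    rw [h2]; exact h1

/-- The value process of a linear functional of `X_r` is a deflator along `[0,r]`. -/
theorem SolidFork.condExp_mul_value_le {m0 : MeasurableSpace Ω} {μ : Measure Ω}
    [IsProbabilityMeasure μ] {T : ℝ} {ℱ : Filtration ℝ m0} {H : Set (ℝ → Ω → ℝ)}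
    (hH : SolidFork μ T ℱ H) {X₀ : ℝ → Ω → ℝ} (hX₀ : X₀ ∈ H) {u v r : ℝ} (hu : 0 ≤ u)
    (huv : u ≤ v) (hvr : v ≤ r) (hrT : r ≤ T) (hpos : ∀ᵐ ω ∂μ, 0 < X₀ r ω) {g φu φv : Ω → ℝ}
    {N : ℝ} (hgm : StronglyMeasurable[ℱ r] g) (hg0 : ∀ ω, 0 ≤ g ω) (hgN : ∀ ω, g ω ≤ N)
    (hφum : StronglyMeasurable[ℱ u] φu) (hφu0 : ∀ ω, 0 ≤ φu ω) (hφuN : ∀ ω, φu ω ≤ N)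
    (hφvm : StronglyMeasurable[ℱ v] φv) (hφv0 : ∀ ω, 0 ≤ φv ω) (hφvN : ∀ ω, φv ω ≤ N)
    (hφu : ∀ X ∈ H, μ[fun ω => X r ω * g ω | ℱ u] ≤ᵐ[μ] fun ω => X u ω * φu ω)
    {Xn : ℕ → ℝ → Ω → ℝ} (hXn : ∀ n, Xn n ∈ H ∧ Xn n v =ᵐ[μ] X₀ v)
    (hφv : ∀ᵐ ω ∂μ, Tendsto (fun n => (μ[fun ω => Xn n r ω * g ω | ℱ v]) ω) atTop
      (nhds (X₀ v ω * φv ω)))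
    {X : ℝ → Ω → ℝ} (hX : X ∈ H) :
    μ[fun ω => X v ω * φv ω | ℱ u] ≤ᵐ[μ] fun ω => X u ω * φu ω := by
  have hrm : r ∈ Icc 0 T := ⟨hu.trans (huv.trans hvr), hrT⟩
  have hvm : v ∈ Icc 0 T := ⟨hu.trans huv, hvr.trans hrT⟩
  have hum : u ∈ Icc 0 T := ⟨hu, huv.trans hvm.2⟩
  have hInt : ∀ (w : ℝ) (hw : w ∈ Icc 0 T) (θ : Ω → ℝ), StronglyMeasurable[ℱ w] θ →
      (∀ ω, 0 ≤ θ ω) → (∀ ω, θ ω ≤ N) → ∀ X ∈ H, Integrable (fun ω => X w ω * θ ω) μ :=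
    fun w hw θ hm h0 hN X hX =>
      ((hH.superMG hX).2.1 w hw).mul_bdd (c := N) (hm.mono (ℱ.le w)).aestronglyMeasurable
        (ae_of_all _ fun ω => by rw [Real.norm_of_nonneg (h0 ω)]; exact hN ω)
  have hposv : ∀ᵐ ω ∂μ, 0 < X₀ v ω := (hH.superMG hX₀).ae_pos_of_ae_pos hvm hrm hvr hpos
  choose Z hZ hZ1 hZ2 using fun n => hH.exists_paste hvm hX (hXn n).1
  have hpull : ∀ n, μ[fun ω => Z n r ω * g ω | ℱ v] =ᵐ[μ]
      fun ω => X v ω / X₀ v ω * (μ[fun ω => Xn n r ω * g ω | ℱ v]) ω := by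
    intro n
    have h1 : (fun ω => Z n r ω * g ω) =ᵐ[μ]
        fun ω => X v ω / X₀ v ω * (Xn n r ω * g ω) := by
      filter_upwards [(hXn n).2] with ω h
      rw [hZ2 n r hvr ω, h]; ring
    refine (condExp_congr_ae h1).trans ?_
    exact condExp_mul_of_stronglyMeasurable_left
      (stronglyMeasurable_div_real ((hH.superMG hX).1.1 v hvm)
        ((hH.superMG hX₀).1.1 v hvm))
      ((hInt r hrm g hgm hg0 hgN _ (hZ n)).congr h1) (hInt r hrm g hgm hg0 hgN _ (hXn n).1)
  have hZu : ∀ n, Z n u =ᵐ[μ] X u := by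
    intro n
    rcases huv.eq_or_lt with rfl | h
    · filter_upwards [(hXn n).2, hposv] with ω h1 h2
      rw [hZ2 n u le_rfl ω, h1, div_self h2.ne', mul_one]
    · rw [hZ1 n u h]
  refine condExp_le_of_tendsto (ℱ.le u) (hInt v hvm φv hφvm hφv0 hφvN X hX)
    (hInt u hum φu hφum hφu0 hφuN X hX) (((hH.superMG hX).1.1 u hum).mul hφum)
    (Wn := fun n => μ[fun ω => Z n r ω * g ω | ℱ v]) (Vn := fun _ ω => X u ω * φu ω)
    (fun n => integrable_condExp) (fun _ => hInt u hum φu hφum hφu0 hφuN X hX)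
    (fun n => condExp_nonneg ?_) (fun _ => ?_) ?_ (ae_of_all _ fun _ => tendsto_const_nhds)
    (fun j => Eventually.of_forall fun i => ⟨ℱ u, le_rfl, ℱ.le u, ?_⟩)
  · filter_upwards [(hH.superMG (hZ n)).ae_nonneg hrm] with ω h using mul_nonneg h (hg0 ω)
  · filter_upwards [(hH.superMG hX).ae_nonneg hum] with ω h using mul_nonneg h (hφu0 ω)
  · filter_upwards [ae_all_iff.2 hpull, hφv, hposv] with ω h1 h2 h3
    simp only [h1]
    have := h2.const_mul (X v ω / X₀ v ω)
    rwa [show X v ω / X₀ v ω * (X₀ v ω * φv ω) = X v ω * φv ω by field_simp] at this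
  · have h1 := condExp_condExp_of_le (f := fun ω => Z i r ω * g ω) (μ := μ)
      (ℱ.mono huv) (ℱ.le v)
    filter_upwards [h1, hφu _ (hZ i), hZu i] with ω h1 h2 h3
    rw [h1, ← h3]; exact h2

theorem exists_seq_gridSet {s r u v : ℝ} (hu : u ∈ Ico s r) (huv : u < v) :
    ∃ q : ℕ → ℝ, (∀ n, q n ∈ gridSet s r ∧ u < q n ∧ q n < v) ∧
      Tendsto q atTop (nhdsWithin u (gridSet s r ∩ Ioi u)) := by
  have := neBot_nhdsWithin_Ioi_of_between (Q := gridSet s r)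
    (fun x y hx hxy hy => exists_gridSet_between hx hxy hy) hu
  obtain ⟨q, hq⟩ := exists_seq_tendsto (nhdsWithin u (gridSet s r ∩ Ioi u))
  have h1 : ∀ᶠ x in nhdsWithin u (gridSet s r ∩ Ioi u), x ∈ gridSet s r ∧ u < x ∧ x < v := by
    filter_upwards [self_mem_nhdsWithin, nhdsWithin_le_nhds (Iio_mem_nhds huv)] with x hx hv
    exact ⟨hx.1, hx.2, hv⟩
  obtain ⟨K, hK⟩ := eventually_atTop.1 (hq.eventually h1)
  exact ⟨fun n => q (n + K), fun n => hK _ (Nat.le_add_left _ _),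
    hq.comp (tendsto_add_atTop_nat K)⟩

theorem stronglyMeasurable_rightReg_gridSet {m0 : MeasurableSpace Ω} (ℱ : Filtration ℝ m0)
    (hrc : ∀ t : ℝ, (ℱ t : MeasurableSpace Ω) = ⨅ (s : ℝ) (_ : t < s), ℱ s) {s r : ℝ}
    (hsr : s < r) {φ : ℝ → Ω → ℝ} (hφ : ∀ u ∈ Icc s r, StronglyMeasurable[ℱ u] (φ u))
    {u : ℝ} (hu : u ∈ Ico s r)
    (hlim : ∀ ω, ∃ L, Tendsto (fun q => φ q ω) (nhdsWithin u (gridSet s r ∩ Ioi u)) (nhds L)) :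
    StronglyMeasurable[ℱ u] fun ω => rightReg (gridSet s r) (fun q => φ q ω) u := by
  have key : ∀ v, u < v →
      StronglyMeasurable[ℱ v] fun ω => rightReg (gridSet s r) (fun q => φ q ω) u := by
    intro v huv
    obtain ⟨q, hq, hqu⟩ := exists_seq_gridSet hu huv
    refine stronglyMeasurable_of_tendsto atTop (f := fun n => φ (q n)) (fun n => ?_) ?_
    · exact (hφ _ (gridSet_subset hsr (hq n).1)).mono (ℱ.mono (hq n).2.2.le)
    · exact tendsto_pi_nhds.2 fun ω => (tendsto_rightReg (hlim ω)).comp hqu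
  refine Measurable.stronglyMeasurable fun B hB => ?_
  rw [hrc u]
  simp only [MeasurableSpace.measurableSet_iInf]
  exact fun v hv => (key v hv).measurable hB

/-- For `0 ≤ g ≤ 1` there is an element `Z` of the process polar with `Z_r = g` whose value at `s`
is dominated by the limit of conditional expectations of `X_r g` over processes agreeing with `X₀`
at time `s`. -/
theorem SolidFork.exists_mem_procPolar {m0 : MeasurableSpace Ω} {μ : Measure Ω}
    [IsProbabilityMeasure μ] {T : ℝ} {ℱ : Filtration ℝ m0}
    (hrc : ∀ t : ℝ, (ℱ t : MeasurableSpace Ω) = ⨅ (s : ℝ) (_ : t < s), ℱ s)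
    (hcomp : ∀ A : Set Ω, μ A = 0 → MeasurableSet[ℱ 0] A) {H : Set (ℝ → Ω → ℝ)}
    (hH : SolidFork μ T ℱ H) {X₀ : ℝ → Ω → ℝ} (hX₀ : X₀ ∈ H) {s r : ℝ} (hs : 0 ≤ s)
    (hsr : s < r) (hrT : r ≤ T) (hpos : ∀ᵐ ω ∂μ, 0 < X₀ r ω) {g : Ω → ℝ}
    (hgm : StronglyMeasurable[ℱ r] g) (hg0 : ∀ ω, 0 ≤ g ω) (hg1 : ∀ ω, g ω ≤ 1) :
    ∃ Z ∈ procPolar μ T ℱ H, Z r = g ∧ ∃ Xn : ℕ → ℝ → Ω → ℝ,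
      (∀ n, Xn n ∈ H ∧ Xn n s =ᵐ[μ] X₀ s) ∧ ∃ U : Ω → ℝ,
      (∀ᵐ ω ∂μ, Tendsto (fun n => (μ[fun ω => Xn n r ω * g ω | ℱ s]) ω) atTop (nhds (U ω))) ∧
      ∀ᵐ ω ∂μ, X₀ s ω * Z s ω ≤ U ω := by
  have hT : ∀ u ∈ Icc s r, u ∈ Icc 0 T := fun u hu => ⟨hs.trans hu.1, hu.2.trans hrT⟩
  have hex : ∀ u, ∃ φ : Ω → ℝ, (∀ ω, 0 ≤ φ ω) ∧ (∀ ω, φ ω ≤ 1) ∧ (u ∈ Icc s r →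
      StronglyMeasurable[ℱ u] φ ∧
      (∀ X ∈ H, μ[fun ω => X r ω * g ω | ℱ u] ≤ᵐ[μ] fun ω => X u ω * φ ω) ∧
      ∃ Xn : ℕ → ℝ → Ω → ℝ, (∀ n, Xn n ∈ H ∧ Xn n u =ᵐ[μ] X₀ u) ∧
        ∀ᵐ ω ∂μ, Tendsto (fun n => (μ[fun ω => Xn n r ω * g ω | ℱ u]) ω) atTop
          (nhds (X₀ u ω * φ ω))) := by
    intro u
    by_cases hu : u ∈ Icc s r
    · obtain ⟨φ, h1, h2, h3, h4, h5⟩ := hH.exists_value hX₀ (hs.trans hu.1) hu.2 hrT hpos hgm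
        hg0 hg1 zero_le_one
      exact ⟨φ, h2, h3, fun _ => ⟨h1, h4, h5⟩⟩
    · exact ⟨fun _ => 0, fun _ => le_rfl, fun _ => zero_le_one, fun h => absurd h hu⟩
  choose φ hφ0 hφ1 hφ using hex
  have hφs : ∀ X ∈ H, ∀ u ∈ Icc s r, ∀ v ∈ Icc s r, u ≤ v →
      μ[fun ω => X v ω * φ v ω | ℱ u] ≤ᵐ[μ] fun ω => X u ω * φ u ω := by
    intro X hX u hu v hv huv
    obtain ⟨Xn, hXn, hlim⟩ := (hφ v hv).2.2
    exact hH.condExp_mul_value_le hX₀ (hs.trans hu.1) huv hv.2 hrT hpos hgm hg0 hg1 (hφ u hu).1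
      (hφ0 u) (hφ1 u) (hφ v hv).1 (hφ0 v) (hφ1 v) (hφ u hu).2.1 hXn hlim hX
  have hG := ae_exists_tendsto_gridSet ℱ hs hsr hrT X₀ (hH.superMG hX₀) hpos φ 1
    (fun u hu => (hφ u hu).1) hφ0 hφ1 (hφs X₀ hX₀)
  set G : Set Ω := {ω | (∀ u ∈ Ico s r, ∃ L, Tendsto (fun q => φ q ω)
        (nhdsWithin u (gridSet s r ∩ Ioi u)) (nhds L)) ∧
      (∀ u ∈ Ioc s r, ∃ L, Tendsto (fun q => φ q ω)
        (nhdsWithin u (gridSet s r ∩ Iio u)) (nhds L))} with hGdef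
  have hGm : MeasurableSet[ℱ 0] G := by
    rw [← compl_compl G]; exact (hcomp _ (mem_ae_iff.1 hG)).compl
  let θ : ℝ → Ω → ℝ := fun u => G.indicator (φ u)
  have hθ : ∀ u, θ u =ᵐ[μ] φ u := fun u => by
    filter_upwards [hG] with ω hω using indicator_of_mem (show ω ∈ G from hω) _
  have hθm : ∀ u ∈ Icc s r, StronglyMeasurable[ℱ u] (θ u) := fun u hu =>
    (hφ u hu).1.indicator (ℱ.mono (hT u hu).1 _ hGm)
  have hθ0 : ∀ u ω, 0 ≤ θ u ω := fun u ω => indicator_nonneg (fun ω _ => hφ0 u ω) ω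
  have hθ1 : ∀ u ω, θ u ω ≤ 1 := fun u ω =>
    indicator_le' (fun ω _ => hφ1 u ω) (fun _ _ => zero_le_one) ω
  have hlimr : ∀ ω, ∀ u ∈ Ico s r, ∃ L, Tendsto (fun q => θ q ω)
      (nhdsWithin u (gridSet s r ∩ Ioi u)) (nhds L) := by
    intro ω u hu
    by_cases h : ω ∈ G
    · simp only [θ, indicator_of_mem h]; exact h.1 u hu
    · simp only [θ, indicator_of_notMem h]; exact ⟨0, tendsto_const_nhds⟩
  have hliml : ∀ ω, ∀ u ∈ Ioc s r, ∃ L, Tendsto (fun q => θ q ω)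
      (nhdsWithin u (gridSet s r ∩ Iio u)) (nhds L) := by
    intro ω u hu
    by_cases h : ω ∈ G
    · simp only [θ, indicator_of_mem h]; exact h.2 u hu
    · simp only [θ, indicator_of_notMem h]; exact ⟨0, tendsto_const_nhds⟩
  have hθs : ∀ X ∈ H, ∀ u ∈ Icc s r, ∀ v ∈ Icc s r, u ≤ v →
      μ[fun ω => X v ω * θ v ω | ℱ u] ≤ᵐ[μ] fun ω => X u ω * θ u ω := by
    intro X hX u hu v hv huv
    have h1 : (fun ω => X v ω * θ v ω) =ᵐ[μ] fun ω => X v ω * φ v ω := by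
      filter_upwards [hθ v] with ω h; rw [h]
    filter_upwards [condExp_congr_ae (m := ℱ u) h1, hφs X hX u hu v hv huv, hθ u] with ω h1 h2 h3
    rw [h1, h3]; exact h2
  let R : ℝ → Ω → ℝ := fun u ω => rightReg (gridSet s r) (fun q => θ q ω) u
  have hdense : ∀ x y, s ≤ x → x < y → y ≤ r → ∃ q ∈ gridSet s r, x < q ∧ q < y :=
    fun x y hx hxy hy => exists_gridSet_between hx hxy hy
  have hRm : ∀ u ∈ Ico s r, StronglyMeasurable[ℱ u] (R u) := fun u hu =>
    stronglyMeasurable_rightReg_gridSet ℱ hrc hsr hθm hu fun ω => hlimr ω u hu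
  have hR01 : ∀ u ∈ Ico s r, ∀ ω, R u ω ∈ Icc (0 : ℝ) 1 := fun u hu ω =>
    rightReg_mem_of_forall isClosed_Icc hdense hu (hlimr ω u hu) le_rfl hu.2
      fun q _ _ _ => ⟨hθ0 q ω, hθ1 q ω⟩
  let Z : ℝ → Ω → ℝ := fun u ω => if u < r then (if u < s then 1 else R u ω) else g ω
  have hZlt : ∀ u < s, Z u = fun _ => 1 := fun u hu => by
    ext ω; simp [Z, hu, hu.trans hsr]
  have hZmid : ∀ u ∈ Ico s r, Z u = R u := fun u hu => by
    ext ω; simp [Z, hu.2, not_lt.2 hu.1]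
  have hZge : ∀ u, r ≤ u → Z u = g := fun u hu => by
    ext ω; simp [Z, not_lt.2 hu]
  have hcase : ∀ u, u < s ∨ u ∈ Ico s r ∨ r ≤ u := fun u => by
    rcases lt_or_ge u s with h | h
    · exact Or.inl h
    · rcases lt_or_ge u r with h' | h'
      · exact Or.inr (Or.inl ⟨h, h'⟩)
      · exact Or.inr (Or.inr h')
  have hZm : ∀ u, StronglyMeasurable[ℱ u] (Z u) := by
    intro u
    rcases hcase u with h | h | h
    · rw [hZlt u h]; exact stronglyMeasurable_const
    · rw [hZmid u h]; exact hRm u h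
    · rw [hZge u h]; exact hgm.mono (ℱ.mono h)
  have hZ01 : ∀ u ω, Z u ω ∈ Icc (0 : ℝ) 1 := by
    intro u ω
    rcases hcase u with h | h | h
    · rw [hZlt u h]; exact ⟨zero_le_one, le_rfl⟩
    · rw [hZmid u h]; exact hR01 u h ω
    · rw [hZge u h]; exact ⟨hg0 ω, hg1 ω⟩
  have hZc : ∀ ω, CadlagOn T (fun u => Z u ω) := by
    intro ω
    refine CadlagOn.ite (CadlagOn.ite (cadlagOn_const s 1) (fun u hu => ?_) fun u hu => ?_)
      (fun _ _ => tendsto_const_nhds) (fun _ _ => ⟨_, tendsto_const_nhds⟩)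
    · exact rightReg_tendsto_right hdense (hlimr ω) hu
    · obtain ⟨L, hL⟩ := hliml ω u hu
      exact ⟨L, rightReg_tendsto_left hdense (hlimr ω) hu hL⟩
  have hbdd : ∀ X ∈ H, ∀ u ∈ Icc 0 T, ∀ ζ : Ω → ℝ, StronglyMeasurable[ℱ u] ζ →
      (∀ ω, 0 ≤ ζ ω) → (∀ ω, ζ ω ≤ 1) → Integrable (fun ω => X u ω * ζ ω) μ :=
    fun X hX u hu ζ hm h0 h1 =>
      ((hH.superMG hX).2.1 u hu).mul_bdd (c := 1) (hm.mono (ℱ.le u)).aestronglyMeasurable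
        (ae_of_all _ fun ω => by rw [Real.norm_of_nonneg (h0 ω)]; exact h1 ω)
  have hbdd0 : ∀ X ∈ H, ∀ u ∈ Icc 0 T, ∀ ζ : Ω → ℝ, (∀ ω, 0 ≤ ζ ω) →
      0 ≤ᵐ[μ] fun ω => X u ω * ζ ω := fun X hX u hu ζ h0 => by
    filter_upwards [(hH.superMG hX).ae_nonneg hu] with ω h using mul_nonneg h (h0 ω)
  have hZi : ∀ X ∈ H, ∀ u ∈ Icc 0 T, Integrable (fun ω => X u ω * Z u ω) μ := fun X hX u hu =>
    hbdd X hX u hu (Z u) (hZm u) (fun ω => (hZ01 u ω).1) (fun ω => (hZ01 u ω).2)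
  have hconv : ∀ X ∈ H, ∀ u ∈ Ico s r, ∀ q : ℕ → ℝ,
      Tendsto q atTop (nhdsWithin u (gridSet s r ∩ Ioi u)) →
      ∀ᵐ ω ∂μ, Tendsto (fun n => X (q n) ω * θ (q n) ω) atTop (nhds (X u ω * Z u ω)) := by
    intro X hX u hu q hq
    filter_upwards [(hH.superMG hX).1.2.2] with ω hω
    rw [hZmid u hu]
    refine ((hω.1 u ⟨hs.trans hu.1, hu.2.trans_le hrT⟩).comp
      (hq.mono_right (nhdsWithin_mono _ inter_subset_right))).mul ?_
    exact (tendsto_rightReg (hlimr ω u hu)).comp hq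
  have hθi : ∀ X ∈ H, ∀ u ∈ Icc s r, Integrable (fun ω => X u ω * θ u ω) μ := fun X hX u hu =>
    hbdd X hX u (hT u hu) (θ u) (hθm u hu) (hθ0 u) (hθ1 u)
  have hgrid : ∀ X ∈ H, ∀ u ∈ Ico s r, ∀ v ∈ Icc s r, u < v →
      μ[fun ω => X v ω * θ v ω | ℱ u] ≤ᵐ[μ] fun ω => X u ω * Z u ω := by
    intro X hX u hu v hv huv
    have hu' := hT u ⟨hu.1, hu.2.le⟩
    obtain ⟨q, hq, hqu⟩ := exists_seq_gridSet hu huv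
    have hqm : ∀ n, q n ∈ Icc s r := fun n => gridSet_subset hsr (hq n).1
    refine condExp_le_of_tendsto (ℱ.le u) (hθi X hX v hv) (hZi X hX u hu')
      (((hH.superMG hX).1.1 u hu').mul (hZm u))
      (Wn := fun _ ω => X v ω * θ v ω) (Vn := fun n ω => X (q n) ω * θ (q n) ω)
      (fun _ => hθi X hX v hv) (fun n => hθi X hX _ (hqm n))
      (fun _ => hbdd0 X hX v (hT v hv) _ (hθ0 v)) (fun n => hbdd0 X hX _ (hT _ (hqm n)) _ (hθ0 _))
      (ae_of_all _ fun _ => tendsto_const_nhds) (hconv X hX u hu q hqu)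
      fun j => Eventually.of_forall fun _ => ⟨ℱ (q j), ℱ.mono (hq j).2.1.le, ℱ.le _, ?_⟩
    exact hθs X hX (q j) (hqm j) v hv (hq j).2.2.le
  have hsup : ∀ X ∈ H, ∀ u v : ℝ, u ∈ Icc 0 T → v ∈ Icc 0 T → u ≤ v →
      μ[fun ω => X v ω * Z v ω | ℱ u] ≤ᵐ[μ] fun ω => X u ω * Z u ω := by
    intro X hX u v hu hv huv
    have hXs := hH.superMG hX
    have hlast : ∀ u v : ℝ, r ≤ u → u ∈ Icc 0 T → v ∈ Icc 0 T → u ≤ v →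
        μ[fun ω => X v ω * g ω | ℱ u] ≤ᵐ[μ] fun ω => X u ω * g ω := by
      intro u v hru hu hv huv
      have hgu := hgm.mono (ℱ.mono hru)
      have h1 := condExp_mul_of_stronglyMeasurable_right (m := ℱ u) (μ := μ) (f := X v) hgu
        (hbdd X hX v hv g (hgm.mono (ℱ.mono (hru.trans huv))) hg0 hg1) (hXs.2.1 v hv)
      filter_upwards [h1, hXs.2.2 u v hu hv huv] with ω h1 h2
      exact (le_of_eq h1).trans (mul_le_mul_of_nonneg_right h2 (hg0 ω))
    rcases huv.eq_or_lt with rfl | huv'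
    · rw [condExp_of_stronglyMeasurable (f := fun ω => X u ω * Z u ω) (ℱ.le u)
        ((hXs.1.1 u hu).mul (hZm u)) (hZi X hX u hu)]
    rcases hcase u with h | h | h
    · rw [hZlt u h]
      have h1 : μ[fun ω => X v ω * Z v ω | ℱ u] ≤ᵐ[μ] μ[X v | ℱ u] :=
        condExp_mono (hZi X hX v hv) (hXs.2.1 v hv) (by
          filter_upwards [hXs.ae_nonneg hv] with ω h
          exact mul_le_of_le_one_right h (hZ01 v ω).2)
      filter_upwards [h1, hXs.2.2 u v hu hv huv] with ω h1 h2
      rw [mul_one]; exact h1.trans h2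
    · have hu' : u ∈ Icc s r := ⟨h.1, h.2.le⟩
      rcases lt_or_ge v r with hvr | hvr
      · have hv' : v ∈ Ico s r := ⟨h.1.trans huv, hvr⟩
        obtain ⟨q, hq, hqu⟩ := exists_seq_gridSet h huv'
        obtain ⟨p, hp, hpv⟩ := exists_seq_gridSet hv' hvr
        have hqm : ∀ n, q n ∈ Icc s r := fun n => gridSet_subset hsr (hq n).1
        have hpm : ∀ n, p n ∈ Icc s r := fun n => gridSet_subset hsr (hp n).1
        refine condExp_le_of_tendsto (ℱ.le u) (hZi X hX v hv) (hZi X hX u hu)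
          ((hXs.1.1 u hu).mul (hZm u))
          (Wn := fun n ω => X (p n) ω * θ (p n) ω) (Vn := fun n ω => X (q n) ω * θ (q n) ω)
          (fun n => hθi X hX _ (hpm n)) (fun n => hθi X hX _ (hqm n))
          (fun n => hbdd0 X hX _ (hT _ (hpm n)) _ (hθ0 _))
          (fun n => hbdd0 X hX _ (hT _ (hqm n)) _ (hθ0 _))
          (hconv X hX v hv' p hpv) (hconv X hX u h q hqu)
          fun j => Eventually.of_forall fun i => ⟨ℱ (q j), ℱ.mono (hq j).2.1.le, ℱ.le _, ?_⟩
        exact hθs X hX (q j) (hqm j) (p i) (hpm i) ((hq j).2.2.trans (hp i).2.1).le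
      · have hrm : r ∈ Icc s r := right_mem_Icc.2 hsr.le
        have hgi := hbdd X hX r (hT r hrm) g hgm hg0 hg1
        have h1 : μ[fun ω => X v ω * g ω | ℱ r] ≤ᵐ[μ] fun ω => X r ω * θ r ω := by
          have h2 := (hφ r hrm).2.1 X hX
          rw [condExp_of_stronglyMeasurable (f := fun ω => X r ω * g ω) (ℱ.le r)
            ((hXs.1.1 r (hT r hrm)).mul hgm) hgi] at h2
          filter_upwards [hlast r v le_rfl (hT r hrm) hv hvr, h2, hθ r] with ω h1 h2 h3
          rw [h3]; exact h1.trans h2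
        have h2 := condExp_mono (m := ℱ u) integrable_condExp (hθi X hX r hrm) h1
        have h3 := condExp_condExp_of_le (f := fun ω => X v ω * g ω) (μ := μ)
          (ℱ.mono h.2.le) (ℱ.le r)
        rw [hZge v hvr]
        filter_upwards [h2, h3, hgrid X hX u h r hrm h.2] with ω h2 h3 h4
        rw [← h3]; exact h2.trans h4
    · rw [hZge u h, hZge v (h.trans huv)]
      exact hlast u v h hu hv huv
  have h0T : (0 : ℝ) ∈ Icc 0 T := ⟨le_rfl, hs.trans (hsr.le.trans hrT)⟩
  have hsm : s ∈ Icc s r := left_mem_Icc.2 hsr.le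
  have hsm' : s ∈ Ico s r := left_mem_Ico.2 hsr
  refine ⟨Z, ⟨⟨fun u _ => hZm u, ae_of_all _ fun ω u _ => (hZ01 u ω).1, ae_of_all _ hZc⟩,
    fun X hX => ⟨⟨⟨fun u hu => ((hH.superMG hX).1.1 u hu).mul (hZm u), ?_, ?_⟩, hZi X hX,
      hsup X hX⟩, ?_⟩⟩, hZge r le_rfl, ?_⟩
  · filter_upwards [(hH.superMG hX).1.2.1] with ω hω u hu
    exact mul_nonneg (hω u hu) (hZ01 u ω).1
  · filter_upwards [(hH.superMG hX).1.2.2] with ω hω using hω.mul (hZc ω)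
  · filter_upwards [(hH.sub X hX).2, (hH.superMG hX).ae_nonneg h0T] with ω h1 h2
    exact (mul_le_of_le_one_right h2 (hZ01 0 ω).2).trans h1
  · obtain ⟨Xn, hXn, hlim⟩ := (hφ s hsm).2.2
    refine ⟨Xn, hXn, fun ω => X₀ s ω * φ s ω, hlim, ?_⟩
    obtain ⟨q, hq, hqu⟩ := exists_seq_gridSet hsm' hsr
    have hqm : ∀ n, q n ∈ Icc s r := fun n => gridSet_subset hsr (hq n).1
    have hsmZ := ((hH.superMG hX₀).1.1 s (hT s hsm)).mul (hZm s)
    have h1 : μ[fun ω => X₀ s ω * Z s ω | ℱ s] ≤ᵐ[μ] fun ω => X₀ s ω * θ s ω :=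
      condExp_le_of_tendsto (ℱ.le s) (hZi X₀ hX₀ s (hT s hsm)) (hθi X₀ hX₀ s hsm)
        (((hH.superMG hX₀).1.1 s (hT s hsm)).mul (hθm s hsm))
        (Wn := fun n ω => X₀ (q n) ω * θ (q n) ω) (Vn := fun _ ω => X₀ s ω * θ s ω)
        (fun n => hθi X₀ hX₀ _ (hqm n)) (fun _ => hθi X₀ hX₀ s hsm)
        (fun n => hbdd0 X₀ hX₀ _ (hT _ (hqm n)) _ (hθ0 _))
        (fun _ => hbdd0 X₀ hX₀ s (hT s hsm) _ (hθ0 s))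
        (hconv X₀ hX₀ s hsm' q hqu) (ae_of_all _ fun _ => tendsto_const_nhds)
        fun _ => Eventually.of_forall fun i => ⟨ℱ s, le_rfl, ℱ.le s,
          hθs X₀ hX₀ s hsm (q i) (hqm i) (hq i).2.1.le⟩
    rw [condExp_of_stronglyMeasurable (f := fun ω => X₀ s ω * Z s ω) (ℱ.le s) hsmZ (hZi X₀ hX₀ s (hT s hsm))] at h1
    filter_upwards [h1, hθ s] with ω h1 h2
    rw [← h2]; exact h1

theorem ae_tendsto_zero_of_integral_sq_le {m0 : MeasurableSpace Ω} {μ : Measure Ω}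
    {d : ℕ → Ω → ℝ} (hd : ∀ k, Integrable (fun ω => d k ω ^ 2) μ)
    (h : ∀ k, ∫ ω, d k ω ^ 2 ∂μ ≤ (1 / 2) ^ k) :
    ∀ᵐ ω ∂μ, Tendsto (fun k => d k ω) atTop (nhds 0) := by
  have hm : ∀ k, AEMeasurable (fun ω => ENNReal.ofReal (d k ω ^ 2)) μ := fun k =>
    (hd k).aemeasurable.ennreal_ofReal
  have hsum : ∫⁻ ω, ∑' k, ENNReal.ofReal (d k ω ^ 2) ∂μ ≠ ∞ := by
    rw [lintegral_tsum hm]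
    have hle : ∀ k, ∫⁻ ω, ENNReal.ofReal (d k ω ^ 2) ∂μ ≤ ENNReal.ofReal ((1 / 2) ^ k) := by
      intro k
      rw [← ofReal_integral_eq_lintegral_ofReal (hd k) (ae_of_all _ fun ω => sq_nonneg _)]
      exact ENNReal.ofReal_le_ofReal (h k)
    refine ne_top_of_le_ne_top ?_ (ENNReal.tsum_le_tsum hle)
    rw [← ENNReal.ofReal_tsum_of_nonneg (fun k => by positivity) summable_geometric_two]
    exact ENNReal.ofReal_ne_top
  filter_upwards [ae_lt_top' (AEMeasurable.tsum hm) hsum] with ω hω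
  have h0 := ENNReal.tendsto_atTop_zero_of_tsum_ne_top hω.ne
  have h1 : Tendsto (fun k => d k ω ^ 2) atTop (nhds 0) := by
    have := (ENNReal.tendsto_toReal ENNReal.zero_ne_top).comp h0
    refine this.congr fun k => ?_
    exact ENNReal.toReal_ofReal (sq_nonneg _)
  have h2 := h1.sqrt
  simp only [Real.sqrt_sq_eq_abs, Real.sqrt_zero] at h2
  exact (tendsto_zero_iff_abs_tendsto_zero _).2 h2

theorem const_mem_procPolar {m0 : MeasurableSpace Ω} {μ : Measure Ω} {T : ℝ}
    {ℱ : Filtration ℝ m0} {H : Set (ℝ → Ω → ℝ)} (hH : SolidFork μ T ℱ H) {c : ℝ} (hc : 0 ≤ c)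
    (h : ∀ X ∈ H, ∀ᵐ ω ∂μ, X 0 ω * c ≤ 1) : (fun _ _ => c) ∈ procPolar μ T ℱ H := by
  refine ⟨⟨fun _ _ => stronglyMeasurable_const, ae_of_all _ fun _ _ _ => hc,
    ae_of_all _ fun _ => cadlagOn_const T c⟩, fun X hX => ⟨⟨⟨fun t ht => ?_, ?_, ?_⟩,
    fun t ht => ?_, fun s t hs ht hst => ?_⟩, h X hX⟩⟩
  · exact ((hH.superMG hX).1.1 t ht).mul stronglyMeasurable_const
  · filter_upwards [(hH.superMG hX).1.2.1] with ω hω t ht using mul_nonneg (hω t ht) hc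
  · filter_upwards [(hH.superMG hX).1.2.2] with ω hω using hω.mul (cadlagOn_const T c)
  · exact ((hH.superMG hX).2.1 t ht).mul_const c
  · have h1 : μ[fun ω => X t ω * c | ℱ s] =ᵐ[μ] fun ω => c * (μ[X t | ℱ s]) ω := by
      simp only [mul_comm _ c]
      exact condExp_smul c (X t) (ℱ s)
    filter_upwards [h1, (hH.superMG hX).2.2 s t hs ht hst] with ω h1 h2
    rw [h1, mul_comm]
    exact mul_le_mul_of_nonneg_right h2 hc

theorem SolidFork.superMG_of_bipolar {m0 : MeasurableSpace Ω} {μ : Measure Ω} {T : ℝ}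
    {ℱ : Filtration ℝ m0} {H : Set (ℝ → Ω → ℝ)} (hH : SolidFork μ T ℱ H) {Y : ℝ → Ω → ℝ}
    (hY : Y ∈ procPolar μ T ℱ (procPolar μ T ℱ H)) : SuperMG μ T ℱ Y := by
  have h1 : (fun _ _ => 1) ∈ procPolar μ T ℱ H := const_mem_procPolar hH zero_le_one fun X hX => by
    simpa using (hH.sub X hX).2
  simpa using (hY.2 _ h1).1

theorem SolidFork.integral_le_of_bounded {m0 : MeasurableSpace Ω} {μ : Measure Ω}
    [IsProbabilityMeasure μ] {T : ℝ} {ℱ : Filtration ℝ m0} {H : Set (ℝ → Ω → ℝ)}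
    (hH : SolidFork μ T ℱ H) {s r : ℝ} (hsr : s < r) (hr : r ∈ Icc 0 T)
    {X : ℝ → Ω → ℝ} (hX : X ∈ H) {g : Ω → ℝ} {c : ℝ}
    (hgm : StronglyMeasurable[ℱ r] g) (hg0 : ∀ ω, 0 ≤ g ω) (hg1 : ∀ ω, g ω ≤ 1)
    (h : ∀ Z ∈ H, MemLp (Z r) 2 μ → Z s = X s → ∫ ω, Z r ω * g ω ∂μ ≤ c) :
    ∫ ω, X r ω * g ω ∂μ ≤ c := by
  have hXs := hH.superMG hX
  have hB : ∀ j : ℕ, MeasurableSet[ℱ r] {ω | X r ω ≤ j} := fun j =>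
    (hXs.1.1 r hr).measurable measurableSet_Iic
  choose Z hZ hZ1 hZ2 using fun j : ℕ => hH.exists_mul_from (r := r)
    (η := {ω | X r ω ≤ j}.indicator fun _ => 1) (stronglyMeasurable_const.indicator (hB j))
    (fun ω => indicator_nonneg (fun _ _ => zero_le_one) ω)
    (fun ω => indicator_le' (fun _ _ => le_rfl) (fun _ _ => zero_le_one) ω) hX
  have hZr : ∀ j ω, Z j r ω = {ω | X r ω ≤ j}.indicator (X r) ω := by
    intro j ω
    rw [hZ2 j r le_rfl ω]
    by_cases h : ω ∈ {ω | X r ω ≤ j}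
    · rw [indicator_of_mem h, indicator_of_mem h, mul_one]
    · rw [indicator_of_notMem h, indicator_of_notMem h, mul_zero]
  have hL2 : ∀ j, MemLp (Z j r) 2 μ := by
    intro j
    refine MemLp.of_bound ((((hH.superMG (hZ j)).1.1 r hr).mono (ℱ.le r)).aestronglyMeasurable) j ?_
    filter_upwards [hXs.ae_nonneg hr] with ω h0
    rw [hZr j ω, Real.norm_of_nonneg (indicator_apply_nonneg (fun _ => h0))]
    exact indicator_le' (fun _ h => h) (fun _ _ => Nat.cast_nonneg j) ω
  refine le_of_tendsto' (tendsto_integral_of_dominated_convergence (X r)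
    (F := fun j ω => Z j r ω * g ω) (fun j => ?_) (hXs.2.1 r hr) (fun j => ?_) ?_)
    fun j => h _ (hZ j) (hL2 j) (hZ1 j s hsr)
  · exact ((((hH.superMG (hZ j)).1.1 r hr).mul hgm).mono (ℱ.le r)).aestronglyMeasurable
  · filter_upwards [hXs.ae_nonneg hr] with ω h0
    have h1 : 0 ≤ Z j r ω := by rw [hZr]; exact indicator_apply_nonneg (fun _ => h0)
    have h2 : Z j r ω ≤ X r ω := by rw [hZr]; exact indicator_apply_le' (fun _ => le_rfl) (fun _ => h0)
    rw [Real.norm_of_nonneg (mul_nonneg h1 (hg0 ω))]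
    exact (mul_le_of_le_one_right h1 (hg1 ω)).trans h2
  · refine ae_of_all _ fun ω => ?_
    obtain ⟨K, hK⟩ := exists_nat_ge (X r ω)
    refine tendsto_const_nhds.congr' ?_
    filter_upwards [eventually_ge_atTop K] with j hj
    have hm : ω ∈ {ω | X r ω ≤ j} := hK.trans (Nat.cast_le.2 hj)
    rw [hZr, indicator_of_mem hm]

theorem SolidFork.integral_min_mul_le {m0 : MeasurableSpace Ω} {μ : Measure Ω}
    [IsProbabilityMeasure μ] {T : ℝ} {ℱ : Filtration ℝ m0}
    (hrc : ∀ t : ℝ, (ℱ t : MeasurableSpace Ω) = ⨅ (s : ℝ) (_ : t < s), ℱ s)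
    (hcomp : ∀ A : Set Ω, μ A = 0 → MeasurableSet[ℱ 0] A) {H : Set (ℝ → Ω → ℝ)}
    (hH : SolidFork μ T ℱ H) {X₀ : ℝ → Ω → ℝ} (hX₀ : X₀ ∈ H) {s r : ℝ} (hs : 0 ≤ s)
    (hsr : s < r) (hrT : r ≤ T) (hpos : ∀ᵐ ω ∂μ, 0 < X₀ r ω) {Y : ℝ → Ω → ℝ}
    (hY : Y ∈ procPolar μ T ℱ (procPolar μ T ℱ H)) {g : Ω → ℝ}
    (hgm : StronglyMeasurable[ℱ r] g) (hg0 : ∀ ω, 0 ≤ g ω) (hg1 : ∀ ω, g ω ≤ 1) {n c : ℝ}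
    (hn : 0 ≤ n) (hc : ∀ X ∈ H, X s =ᵐ[μ] X₀ s → ∫ ω, X r ω * g ω ∂μ ≤ c) :
    ∫ ω, min (X₀ s ω * (Y r ω / Y s ω)) n * g ω ∂μ ≤ c := by
  have hsT : s ∈ Icc 0 T := ⟨hs, hsr.le.trans hrT⟩
  have hrT' : r ∈ Icc 0 T := ⟨hs.trans hsr.le, hrT⟩
  obtain ⟨Z, hZ, rfl, Xn, hXn, U, hlim, hU⟩ := hH.exists_mem_procPolar hrc hcomp hX₀ hs hsr hrT
    hpos hgm hg0 hg1
  have hXs := hH.superMG hX₀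
  have hYs := hH.superMG_of_bipolar hY
  have hZY := (hY.2 Z hZ).1
  have hZs0 : 0 ≤ᵐ[μ] Z s := hZ.1.2.1.mono fun ω h => h s hsT
  have hXZ := (hZ.2 X₀ hX₀).1
  have hInt : ∀ i, Integrable (fun ω => Xn i r ω * Z r ω) μ := fun i =>
    (hZ.2 _ (hXn i).1).1.2.1 r hrT'
  have hbd : ∀ i, ∀ᵐ ω ∂μ, ‖(μ[fun ω => Xn i r ω * Z r ω | ℱ s]) ω‖ ≤ X₀ s ω := by
    intro i
    have hi := hH.superMG (hXn i).1
    have h1 : 0 ≤ᵐ[μ] μ[fun ω => Xn i r ω * Z r ω | ℱ s] := condExp_nonneg (by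
      filter_upwards [hi.ae_nonneg hrT'] with ω h using mul_nonneg h (hg0 ω))
    have h2 : μ[fun ω => Xn i r ω * Z r ω | ℱ s] ≤ᵐ[μ] μ[Xn i r | ℱ s] :=
      condExp_mono (hInt i) (hi.2.1 r hrT') (by
        filter_upwards [hi.ae_nonneg hrT'] with ω h using mul_le_of_le_one_right h (hg1 ω))
    filter_upwards [h1, h2, hi.2.2 s r hsT hrT' hsr.le, (hXn i).2] with ω h1 h2 h3 h4
    rw [Real.norm_of_nonneg h1, ← h4]
    exact h2.trans h3
  have hmeas : ∀ i, AEStronglyMeasurable (μ[fun ω => Xn i r ω * Z r ω | ℱ s]) μ := fun i =>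
    integrable_condExp.aestronglyMeasurable
  have hUint : Integrable U μ := by
    refine (hXs.2.1 s hsT).mono' (aestronglyMeasurable_of_tendsto_ae atTop hmeas hlim) ?_
    filter_upwards [ae_all_iff.2 hbd, hlim] with ω h1 h2
    exact le_of_tendsto' h2.norm h1
  have hUc : ∫ ω, U ω ∂μ ≤ c := by
    refine le_of_tendsto' (tendsto_integral_of_dominated_convergence (X₀ s) hmeas
      (hXs.2.1 s hsT) hbd hlim) fun i => ?_
    rw [integral_condExp (ℱ.le s)]
    exact hc _ (hXn i).1 (hXn i).2
  have hXZU : ∫ ω, X₀ s ω * Z s ω ∂μ ≤ c :=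
    (integral_mono_ae (hXZ.2.1 s hsT) hUint hU).trans hUc
  refine le_trans ?_ hXZU
  let w : Ω → ℝ := fun ω => X₀ s ω / Y s ω
  have hwm : StronglyMeasurable[ℱ s] w :=
    stronglyMeasurable_div_real (hXs.1.1 s hsT) (hYs.1.1 s hsT)
  have hw0 : 0 ≤ᵐ[μ] w := by
    filter_upwards [hXs.ae_nonneg hsT, hYs.ae_nonneg hsT] with ω h1 h2 using div_nonneg h1 h2
  have hDm : ∀ k : ℕ, MeasurableSet[ℱ s] {ω | w ω ≤ k} := fun k => hwm.measurable measurableSet_Iic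
  have hym : StronglyMeasurable[ℱ r] fun ω => min (X₀ s ω * (Y r ω / Y s ω)) n * Z r ω :=
    (((((hXs.1.1 s hsT).mono (ℱ.mono hsr.le)).mul (stronglyMeasurable_div_real
      (hYs.1.1 r hrT') ((hYs.1.1 s hsT).mono (ℱ.mono hsr.le)))).measurable.min
      measurable_const).stronglyMeasurable).mul hgm
  have hy0 : ∀ᵐ ω ∂μ, 0 ≤ X₀ s ω * (Y r ω / Y s ω) := by
    filter_upwards [hXs.ae_nonneg hsT, hYs.ae_nonneg hsT, hYs.ae_nonneg hrT'] with ω h1 h2 h3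
    exact mul_nonneg h1 (div_nonneg h3 h2)
  have hyi : Integrable (fun ω => min (X₀ s ω * (Y r ω / Y s ω)) n * Z r ω) μ := by
    refine Integrable.of_bound (hym.mono (ℱ.le r)).aestronglyMeasurable n ?_
    filter_upwards [hy0] with ω h
    have := le_min h hn
    rw [Real.norm_of_nonneg (mul_nonneg this (hg0 ω))]
    exact (mul_le_of_le_one_right this (hg1 ω)).trans (min_le_right _ _)
  have hDU : ⋃ k : ℕ, {ω | w ω ≤ k} = univ :=
    eq_univ_of_forall fun ω => mem_iUnion.2 (exists_nat_ge (w ω))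
  have ht := tendsto_setIntegral_of_monotone (μ := μ) (fun k => ℱ.le s _ (hDm k))
    (fun i j hij ω (hω : w ω ≤ i) => hω.trans (Nat.cast_le.2 hij)) hyi.integrableOn
  rw [hDU, setIntegral_univ] at ht
  refine le_of_tendsto' ht fun k => ?_
  let ζ : Ω → ℝ := {ω | w ω ≤ k}.indicator w
  have hζm : StronglyMeasurable[ℱ s] ζ := hwm.indicator (hDm k)
  have hζ0 : 0 ≤ᵐ[μ] ζ := hw0.mono fun ω h => indicator_apply_nonneg (fun _ => h)
  have hζk : ∀ᵐ ω ∂μ, ‖ζ ω‖ ≤ k := by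
    filter_upwards [hζ0] with ω h
    rw [Real.norm_of_nonneg h]
    exact indicator_le' (fun _ h => h) (fun _ _ => Nat.cast_nonneg k) ω
  have hζi : ∀ u ∈ Icc 0 T, Integrable (fun ω => ζ ω * (Z u ω * Y u ω)) μ := fun u hu =>
    (hZY.2.1 u hu).bdd_mul (hζm.mono (ℱ.le s)).aestronglyMeasurable hζk
  calc ∫ ω in {ω | w ω ≤ k}, min (X₀ s ω * (Y r ω / Y s ω)) n * Z r ω ∂μ
      = ∫ ω, {ω | w ω ≤ k}.indicator
          (fun ω => min (X₀ s ω * (Y r ω / Y s ω)) n * Z r ω) ω ∂μ :=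
        (integral_indicator (ℱ.le s _ (hDm k))).symm
    _ ≤ ∫ ω, ζ ω * (Z r ω * Y r ω) ∂μ := by
        refine integral_mono (hyi.indicator (ℱ.le s _ (hDm k))) (hζi r hrT') fun ω => ?_
        by_cases h : ω ∈ {ω | w ω ≤ k}
        · simp only [ζ, indicator_of_mem h]
          calc _ ≤ X₀ s ω * (Y r ω / Y s ω) * Z r ω :=
                mul_le_mul_of_nonneg_right (min_le_left _ _) (hg0 ω)
            _ = _ := by simp only [w]; ring
        · simp only [ζ, indicator_of_notMem h]; simp
    _ = ∫ ω, (μ[fun ω => ζ ω * (Z r ω * Y r ω) | ℱ s]) ω ∂μ := (integral_condExp (ℱ.le s)).symm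
    _ ≤ ∫ ω, ζ ω * (Z s ω * Y s ω) ∂μ := by
        refine integral_mono_ae integrable_condExp (hζi s hsT) ?_
        have h1 := condExp_mul_of_stronglyMeasurable_left (m := ℱ s) (μ := μ) hζm
          (hζi r hrT') (hZY.2.1 r hrT')
        filter_upwards [h1, hZY.2.2 s r hsT hrT' hsr.le, hζ0] with ω h1 h2 h3
        exact (le_of_eq h1).trans (mul_le_mul_of_nonneg_left h2 h3)
    _ ≤ ∫ ω, X₀ s ω * Z s ω ∂μ := by
        refine integral_mono_ae (hζi s hsT) (hXZ.2.1 s hsT) ?_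
        filter_upwards [hw0, hZs0, hXs.ae_nonneg hsT, hYs.ae_nonneg hsT] with ω h1 h2 h3 h4
        have h5 : ζ ω ≤ w ω := indicator_apply_le' (fun _ => le_rfl) (fun _ => h1)
        calc ζ ω * (Z s ω * Y s ω) ≤ w ω * (Z s ω * Y s ω) :=
              mul_le_mul_of_nonneg_right h5 (mul_nonneg h2 h4)
          _ = Z s ω * (X₀ s ω / Y s ω * Y s ω) := by simp only [w]; ring
          _ ≤ X₀ s ω * Z s ω := by
              rw [mul_comm (X₀ s ω)]
              refine mul_le_mul_of_nonneg_left ?_ h2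
              rcases eq_or_ne (Y s ω) 0 with h | h
              · rw [h]; simpa using h3
              · rw [div_mul_cancel₀ _ h]

/-- One step of the approximation: `X₀_s Y_r / Y_s` is an almost sure limit of values at `r` of
processes that agree with `X₀` at time `s`. -/
theorem SolidFork.exists_seq_step {m0 : MeasurableSpace Ω} {μ : Measure Ω}
    [IsProbabilityMeasure μ] {T : ℝ} {ℱ : Filtration ℝ m0}
    (hrc : ∀ t : ℝ, (ℱ t : MeasurableSpace Ω) = ⨅ (s : ℝ) (_ : t < s), ℱ s)
    (hcomp : ∀ A : Set Ω, μ A = 0 → MeasurableSet[ℱ 0] A) {H : Set (ℝ → Ω → ℝ)}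
    (hH : SolidFork μ T ℱ H) {X₀ : ℝ → Ω → ℝ} (hX₀ : X₀ ∈ H) {s r : ℝ} (hs : 0 ≤ s)
    (hsr : s < r) (hrT : r ≤ T) (hpos : ∀ᵐ ω ∂μ, 0 < X₀ r ω) {Y : ℝ → Ω → ℝ}
    (hY : Y ∈ procPolar μ T ℱ (procPolar μ T ℱ H)) :
    ∃ Xn : ℕ → ℝ → Ω → ℝ, (∀ n, Xn n ∈ H ∧ Xn n s =ᵐ[μ] X₀ s) ∧
      ∀ᵐ ω ∂μ, Tendsto (fun n => Xn n r ω) atTop (nhds (X₀ s ω * (Y r ω / Y s ω))) := by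
  have hsT : s ∈ Icc 0 T := ⟨hs, hsr.le.trans hrT⟩
  have hrT' : r ∈ Icc 0 T := ⟨hs.trans hsr.le, hrT⟩
  have hXs := hH.superMG hX₀
  have hYs := hH.superMG_of_bipolar hY
  have hposs : ∀ᵐ ω ∂μ, 0 < X₀ s ω := hXs.ae_pos_of_ae_pos hsT hrT' hsr.le hpos
  let y : ℕ → Ω → ℝ := fun k ω => min (X₀ s ω * (Y r ω / Y s ω)) (k + 1)
  have hym : ∀ k, StronglyMeasurable[ℱ r] (y k) := fun k =>
    ((((hXs.1.1 s hsT).mono (ℱ.mono hsr.le)).mul (stronglyMeasurable_div_real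
      (hYs.1.1 r hrT') ((hYs.1.1 s hsT).mono (ℱ.mono hsr.le)))).measurable.min
      measurable_const).stronglyMeasurable
  have hy0 : ∀ k, 0 ≤ᵐ[μ] y k := fun k => by
    filter_upwards [hXs.ae_nonneg hsT, hYs.ae_nonneg hsT, hYs.ae_nonneg hrT'] with ω h1 h2 h3
    exact le_min (mul_nonneg h1 (div_nonneg h3 h2)) (by positivity)
  have hy2 : ∀ k, MemLp (y k) 2 μ := fun k => by
    refine MemLp.of_bound ((hym k).mono (ℱ.le r)).aestronglyMeasurable ((k : ℝ) + 1) ?_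
    filter_upwards [hy0 k] with ω h
    rw [Real.norm_of_nonneg h]; exact min_le_right _ _
  have key : ∀ k : ℕ, ∀ ε > 0, ∃ X ∈ H, X s =ᵐ[μ] X₀ s ∧ MemLp (X r) 2 μ ∧
      ∫ ω, (y k ω - X r ω) ^ 2 ∂μ < ε := by
    intro k ε hε
    by_contra! hcon
    let A : Set (Ω → ℝ) := {f | MemLp f 2 μ ∧ ∃ X ∈ H, X s =ᵐ[μ] X₀ s ∧ X r = f}
    have hk : (0 : ℝ) < k + 1 := by positivity
    obtain ⟨g, hgm, hg0, hgk, c, hc, hAc⟩ := exists_separating_of_not_approx (ℱ.le r) A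
      (by
        obtain ⟨Z, hZ, hZ1, hZ2⟩ := hH.exists_mul_from (r := r) (η := fun _ => 0)
          stronglyMeasurable_const (fun _ => le_rfl) (fun _ => zero_le_one) hX₀
        have h0 : Z r = fun _ => 0 := by ext ω; rw [hZ2 r le_rfl ω, mul_zero]
        exact ⟨Z r, by rw [h0]; exact MemLp.zero', Z, hZ, by rw [hZ1 s hsr], rfl⟩)
      (by
        rintro _ ⟨-, X, hX, -, rfl⟩
        exact (hH.superMG hX).1.1 r hrT')
      (fun f hf => hf.1)
      (by
        rintro _ ⟨-, X, hX, -, rfl⟩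
        exact (hH.superMG hX).ae_nonneg hrT')
      (by
        rintro _ ⟨h1, X₁, hX₁, hs₁, rfl⟩ _ ⟨h2, X₂, hX₂, hs₂, rfl⟩ a b ha hb hab
        obtain ⟨Z, hZ, -, hZ2⟩ := hH.exists_fork hsT (h := fun _ => a) stronglyMeasurable_const
          (fun _ => ha) (fun _ => by linarith) hX₀ hX₁ hX₂
        have hb' : 1 - a = b := by linarith
        have hZr : Z r =ᵐ[μ] fun ω => a * X₁ r ω + b * X₂ r ω := by
          filter_upwards [hs₁, hs₂, hposs] with ω h1 h2 h3
          rw [hZ2 r hsr.le ω, h1, h2, hb']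
          field_simp
        refine ⟨Z r, ⟨(memLp_congr_ae hZr).2 ((h1.const_mul a).add (h2.const_mul b)), Z, hZ, ?_,
          rfl⟩, hZr⟩
        filter_upwards [hs₁, hs₂, hposs] with ω h1 h2 h3
        rw [hZ2 s le_rfl ω, h1, h2, hb', div_self h3.ne', mul_one, mul_one, hab, mul_one])
      (by
        rintro _ ⟨h1, X, hX, hXs, rfl⟩ B hB
        obtain ⟨Z, hZ, hZ1, hZ2⟩ := hH.exists_mul_from (r := r) (η := B.indicator fun _ => 1)
          (stronglyMeasurable_const.indicator hB)
          (fun ω => indicator_nonneg (fun _ _ => zero_le_one) ω)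
          (fun ω => indicator_le' (fun _ _ => le_rfl) (fun _ _ => zero_le_one) ω) hX
        have hZr : Z r = B.indicator (X r) := by
          ext ω
          rw [hZ2 r le_rfl ω]
          by_cases h : ω ∈ B
          · rw [indicator_of_mem h, indicator_of_mem h, mul_one]
          · rw [indicator_of_notMem h, indicator_of_notMem h, mul_zero]
        exact ⟨Z r, ⟨by rw [hZr]; exact h1.indicator (ℱ.le r _ hB), Z, hZ, by rwa [hZ1 s hsr],
          rfl⟩, by rw [hZr]⟩)
      (y k) (hym k) (k + 1) hk (hy0 k) (ae_of_all _ fun ω => min_le_right _ _) ε hε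
      (by
        rintro _ ⟨h1, X, hX, hXs, rfl⟩
        exact hcon X hX hXs h1)
    have hdiv : ∀ f : Ω → ℝ, ∫ ω, f ω * (g ω / (k + 1)) ∂μ = (∫ ω, f ω * g ω ∂μ) / (k + 1) :=
      fun f => by rw [← integral_div]; exact integral_congr_ae (ae_of_all _ fun ω => by ring)
    have hgm' : StronglyMeasurable[ℱ r] fun ω => g ω / (k + 1) :=
      stronglyMeasurable_div_real hgm stronglyMeasurable_const
    have hg0' : ∀ ω, 0 ≤ g ω / (k + 1) := fun ω => div_nonneg (hg0 ω) hk.le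
    have hg1' : ∀ ω, g ω / (k + 1) ≤ 1 := fun ω => (div_le_one hk).2 (hgk ω)
    have := hH.integral_min_mul_le hrc hcomp hX₀ hs hsr hrT hpos hY (n := k + 1)
      (c := c / (k + 1)) hgm' hg0' hg1' hk.le fun X hX hXs =>
        hH.integral_le_of_bounded hsr hrT' hX hgm' hg0' hg1' fun Z hZ hZ2 hZs => by
          rw [hdiv]
          exact div_le_div_of_nonneg_right (hAc _ ⟨hZ2, Z, hZ, by rwa [hZs], rfl⟩) hk.le
    rw [hdiv] at this
    exact absurd ((div_le_div_iff_of_pos_right hk).1 this) (not_le.2 hc)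
  choose X hX hXs' hX2 hXε using fun k => key k ((1 / 2) ^ k) (by positivity)
  refine ⟨X, fun n => ⟨hX n, hXs' n⟩, ?_⟩
  filter_upwards [ae_tendsto_zero_of_integral_sq_le
    (fun k => ((hy2 k).sub (hX2 k)).integrable_sq) fun k => (hXε k).le] with ω hω
  have hyl : Tendsto (fun k => y k ω) atTop (nhds (X₀ s ω * (Y r ω / Y s ω))) := by
    obtain ⟨K, hK⟩ := exists_nat_ge (X₀ s ω * (Y r ω / Y s ω))
    refine tendsto_const_nhds.congr' ?_
    filter_upwards [eventually_ge_atTop K] with k hk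
    have : (K : ℝ) ≤ k := Nat.cast_le.2 hk
    exact (min_eq_left (by linarith)).symm
  simpa using hyl.sub hω

theorem SolidFork.exists_seq_zero {m0 : MeasurableSpace Ω} {μ : Measure Ω}
    [IsProbabilityMeasure μ] {T : ℝ} (hT : 0 ≤ T) {ℱ : Filtration ℝ m0}
    (htriv : ∀ A : Set Ω, MeasurableSet[ℱ 0] A → μ A = 0 ∨ μ A = 1) {H : Set (ℝ → Ω → ℝ)}
    (hH : SolidFork μ T ℱ H) {X₀ : ℝ → Ω → ℝ} (hX₀ : X₀ ∈ H) (hpos : ∀ᵐ ω ∂μ, 0 < X₀ 0 ω)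
    {Y : ℝ → Ω → ℝ} (hY : Y ∈ procPolar μ T ℱ (procPolar μ T ℱ H)) :
    ∃ Xn : ℕ → ℝ → Ω → ℝ, (∀ n, Xn n ∈ H) ∧
      ∀ᵐ ω ∂μ, Tendsto (fun n => Xn n 0 ω) atTop (nhds (Y 0 ω)) := by
  have h0T : (0 : ℝ) ∈ Icc 0 T := ⟨le_rfl, hT⟩
  have hconst : ∀ f : Ω → ℝ, StronglyMeasurable[ℱ 0] f → ∀ᵐ ω ∂μ, f ω = ∫ ω, f ω ∂μ := by
    intro f hf
    obtain ⟨c, hc⟩ := Filter.exists_eventuallyEq_const_of_forall_separating (l := ae μ) (f := f)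
      (fun B : Set ℝ => MeasurableSet B) fun B hB => by
        rcases htriv _ (hf.measurable hB) with h | h
        · exact Or.inr (measure_eq_zero_iff_ae_notMem.1 h)
        · exact Or.inl ((prob_compl_eq_zero_iff (ℱ.le 0 _ (hf.measurable hB))).2 h)
    have : ∫ ω, f ω ∂μ = c := by rw [integral_congr_ae hc]; simp
    rw [this]; exact hc
  have hXc : ∀ X ∈ H, ∀ᵐ ω ∂μ, X 0 ω = ∫ ω, X 0 ω ∂μ := fun X hX =>
    hconst _ ((hH.superMG hX).1.1 0 h0T)
  let I : Set ℝ := (fun X : ℝ → Ω → ℝ => ∫ ω, X 0 ω ∂μ) '' H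
  have hI1 : ∀ x ∈ I, x ≤ 1 := by
    rintro _ ⟨X, hX, rfl⟩
    obtain ⟨ω, h1, h2⟩ := ((hXc X hX).and (hH.sub X hX).2).exists
    exact h1.symm.le.trans h2
  have hIb : BddAbove I := ⟨1, hI1⟩
  have hIne : I.Nonempty := ⟨_, X₀, hX₀, rfl⟩
  set a := sSup I with ha
  have ha0 : 0 < a := by
    obtain ⟨ω, h1, h2⟩ := ((hXc X₀ hX₀).and hpos).exists
    exact (h1 ▸ h2 : 0 < ∫ ω, X₀ 0 ω ∂μ).trans_le (le_csSup hIb ⟨X₀, hX₀, rfl⟩)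
  have hpol : (fun _ _ => 1 / a) ∈ procPolar μ T ℱ H :=
    const_mem_procPolar hH (by positivity) fun X hX => by
      filter_upwards [hXc X hX] with ω h
      rw [h, mul_one_div, div_le_one ha0]
      exact le_csSup hIb ⟨X, hX, rfl⟩
  have hYs := hH.superMG_of_bipolar hY
  have hYc := hconst _ (hYs.1.1 0 h0T)
  set y₀ := ∫ ω, Y 0 ω ∂μ with hy₀
  obtain ⟨ω₀, h1, h2, h3⟩ := (hYc.and ((hY.2 _ hpol).2.and (hYs.ae_nonneg h0T))).exists
  have hy0 : 0 ≤ y₀ := h1 ▸ h3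
  have hya : y₀ / a ≤ 1 := by
    rw [h1, one_div_mul_eq_div] at h2; exact h2
  obtain ⟨x, -, hx, hxI⟩ := exists_seq_tendsto_sSup hIne hIb
  choose X hX hXx using hxI
  choose Z hZ hZ1 hZ2 using fun n => hH.exists_mul_from (r := 0) (η := fun _ => y₀ / a)
    stronglyMeasurable_const (fun _ => div_nonneg hy0 ha0.le) (fun _ => hya) (hX n)
  refine ⟨Z, hZ, ?_⟩
  filter_upwards [hYc, ae_all_iff.2 fun n => hXc _ (hX n)] with ω h1 h2
  have h3 : ∀ n, Z n 0 ω = x n * (y₀ / a) := fun n => by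
    rw [hZ2 n 0 le_rfl ω, h2 n]; exact congrArg (· * (y₀ / a)) (hXx n)
  simp only [h3, h1]
  have := hx.mul_const (y₀ / a)
  rwa [mul_div_cancel₀ _ ha0.ne'] at this

theorem procPolar_anti {m0 : MeasurableSpace Ω} {μ : Measure Ω} {T : ℝ}
    {ℱ : Filtration ℝ m0} {C D : Set (ℝ → Ω → ℝ)} (h : C ⊆ D) :
    procPolar μ T ℱ D ⊆ procPolar μ T ℱ C :=
  fun _ hY => ⟨hY.1, fun X hX => hY.2 X (h hX)⟩

theorem subset_solidForkHull {m0 : MeasurableSpace Ω} (μ : Measure Ω) (T : ℝ)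
    (ℱ : Filtration ℝ m0) (C : Set (ℝ → Ω → ℝ)) : C ⊆ solidForkHull μ T ℱ C :=
  subset_sInter fun _ hD => hD.2.2.2

theorem solidFork_solidForkHull {m0 : MeasurableSpace Ω} {μ : Measure Ω} {T : ℝ}
    {ℱ : Filtration ℝ m0} {C D : Set (ℝ → Ω → ℝ)} (hD : D ⊆ {X | S1mem μ T ℱ X})
    (hDs : ProcSolid μ T ℱ D) (hDf : ForkConvex μ T ℱ D) (hCD : C ⊆ D) :
    SolidFork μ T ℱ (solidForkHull μ T ℱ C) where
  sub _ hX := hD (hX D ⟨hD, hDs, hDf, hCD⟩)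
  solid Y hY B hB E hE := hE.2.1 Y (hY E hE) B hB
  fork s hs h hm h0 h1 X₁ hX₁ X₂ hX₂ X₃ hX₃ E hE :=
    hE.2.2.1 s hs h hm h0 h1 X₁ (hX₁ E hE) X₂ (hX₂ E hE) X₃ (hX₃ E hE)

theorem SolidFork.exists_seq_tendsto {m0 : MeasurableSpace Ω} {μ : Measure Ω}
    [IsProbabilityMeasure μ] {T : ℝ} (hT : 0 ≤ T) {ℱ : Filtration ℝ m0}
    (hrc : ∀ t : ℝ, (ℱ t : MeasurableSpace Ω) = ⨅ (s : ℝ) (_ : t < s), ℱ s)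
    (hcomp : ∀ A : Set Ω, μ A = 0 → MeasurableSet[ℱ 0] A)
    (htriv : ∀ A : Set Ω, MeasurableSet[ℱ 0] A → μ A = 0 ∨ μ A = 1) {H : Set (ℝ → Ω → ℝ)}
    (hH : SolidFork μ T ℱ H) {X₀ : ℝ → Ω → ℝ} (hX₀ : X₀ ∈ H) (hpos : ∀ᵐ ω ∂μ, 0 < X₀ T ω)
    {Y : ℝ → Ω → ℝ} (hY : Y ∈ procPolar μ T ℱ (procPolar μ T ℱ H)) {m : ℕ}
    {t : Fin (m + 1) → ℝ} (ht0 : t 0 = 0) (hmono : StrictMono t) (hlast : t (Fin.last m) ≤ T)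
    (k : ℕ) (hk : k ≤ m) :
    ∃ Yn : ℕ → ℝ → Ω → ℝ, (∀ n, Yn n ∈ H) ∧ ∀ᵐ ω ∂μ, ∀ j : Fin (m + 1), (j : ℕ) ≤ k →
      Tendsto (fun n => Yn n (t j) ω) atTop (nhds (Y (t j) ω)) := by
  have hTT : T ∈ Icc 0 T := ⟨hT, le_rfl⟩
  have hposu : ∀ u ∈ Icc 0 T, ∀ᵐ ω ∂μ, 0 < X₀ u ω := fun u hu =>
    (hH.superMG hX₀).ae_pos_of_ae_pos hu hTT hu.2 hpos
  have htm : ∀ j, t j ∈ Icc 0 T := fun j =>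
    ⟨ht0 ▸ hmono.monotone (Fin.zero_le j), (hmono.monotone (Fin.le_last j)).trans hlast⟩
  induction k with
  | zero =>
    obtain ⟨Xn, hXn, hlim⟩ := hH.exists_seq_zero hT htriv hX₀ (hposu 0 ⟨le_rfl, hT⟩) hY
    refine ⟨Xn, hXn, ?_⟩
    filter_upwards [hlim] with ω h j hj
    rw [Fin.ext (Nat.le_zero.1 hj) (b := 0), ht0]
    exact h
  | succ k ih =>
    obtain ⟨Yn, hYn, hYlim⟩ := ih (by omega)
    let i : Fin (m + 1) := ⟨k, by omega⟩
    let l : Fin (m + 1) := ⟨k + 1, by omega⟩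
    have hil : t i < t l := hmono (Fin.mk_lt_mk.2 k.lt_succ_self)
    obtain ⟨Xn, hXn, hXlim⟩ := hH.exists_seq_step hrc hcomp hX₀ (htm i).1 hil (htm l).2
      (hposu _ (htm l)) hY
    choose W hW hW1 hW2 using fun n => hH.exists_paste (htm i) (hYn n) (hXn n).1
    refine ⟨W, hW, ?_⟩
    filter_upwards [hYlim, hXlim, hposu _ (htm i), ae_all_iff.2 fun n => (hXn n).2,
      (hH.superMG_of_bipolar hY).ae_eq_zero_of_eq_zero (htm i) (htm l) hil.le]
      with ω h1 h2 h3 h4 h5 j hj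
    rcases lt_trichotomy (j : ℕ) k with hlt | heq | hgt
    · simpa only [hW1 _ _ (hmono (show j < i from hlt))] using h1 j hlt.le
    · obtain rfl : j = i := Fin.ext heq
      refine (h1 i le_rfl).congr fun n => ?_
      rw [hW2 n _ le_rfl ω, h4 n, div_self h3.ne', mul_one]
    · obtain rfl : j = l := Fin.ext (le_antisymm hj hgt)
      have h6 := (h1 i le_rfl).mul (h2.div_const (X₀ (t i) ω))
      have h7 : Y (t i) ω * (X₀ (t i) ω * (Y (t l) ω / Y (t i) ω) / X₀ (t i) ω) = Y (t l) ω := by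
        rw [mul_div_cancel_left₀ _ h3.ne']
        exact mul_div_cancel_of_imp' h5
      rw [h7] at h6
      refine h6.congr fun n => ?_
      rw [hW2 n _ hil.le ω, h4 n]

/-- Finite-dimensional approximation of elements of the process bipolar by elements
of the solid, fork-convex hull of `C`. -/
theorem bipolar_finite_dim_approx {m0 : MeasurableSpace Ω} (μ : Measure Ω)
    [IsProbabilityMeasure μ] (T : ℝ) (hT : 0 < T) (ℱ : Filtration ℝ m0)
    (hrc : ∀ t : ℝ, (ℱ t : MeasurableSpace Ω) = ⨅ (s : ℝ) (_ : t < s), ℱ s)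
    (hcomp : ∀ A : Set Ω, μ A = 0 → MeasurableSet[ℱ 0] A)
    (htriv : ∀ A : Set Ω, MeasurableSet[ℱ 0] A → μ A = 0 ∨ μ A = 1)
    (C : Set (ℝ → Ω → ℝ)) (hC : ∀ X ∈ C, S1mem μ T ℱ X) (hfar : FarReaching μ T C)
    (m : ℕ) (t : Fin (m + 1) → ℝ) (ht0 : t 0 = 0) (hmono : StrictMono t)
    (hlast : t (Fin.last m) ≤ T)
    (Y : ℝ → Ω → ℝ) (hY : Y ∈ procPolar μ T ℱ (procPolar μ T ℱ C)) :
    ∃ Yn : ℕ → ℝ → Ω → ℝ, (∀ n, Yn n ∈ solidForkHull μ T ℱ C) ∧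
      ∀ᵐ ω ∂μ, ∀ k : Fin (m + 1),
        Filter.Tendsto (fun n => Yn n (t k) ω) Filter.atTop (nhds (Y (t k) ω)) := by
  by_cases hne : ∃ D, D ⊆ {X | S1mem μ T ℱ X} ∧ ProcSolid μ T ℱ D ∧ ForkConvex μ T ℱ D ∧ C ⊆ D
  · obtain ⟨D, hD, hDs, hDf, hCD⟩ := hne
    have hsub := subset_solidForkHull μ T ℱ C
    obtain ⟨X₀, hX₀, hpos⟩ := hfar
    obtain ⟨Yn, hYn, hlim⟩ := (solidFork_solidForkHull hD hDs hDf hCD).exists_seq_tendsto hT.le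
      hrc hcomp htriv (hsub hX₀) hpos (procPolar_anti (procPolar_anti hsub) hY) ht0 hmono hlast
      m le_rfl
    exact ⟨Yn, hYn, hlim.mono fun ω h j => h j (Nat.lt_succ_iff.1 j.2)⟩
  · exact ⟨fun _ => Y, fun _ D hD => (hne ⟨D, hD⟩).elim,
      ae_of_all _ fun _ _ => tendsto_const_nhds⟩
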